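/- Let d ≥ 1, 2 < p < ∞ and 1/p < r < 1/2. There is a constant C (depending only on d, p, r) such that for all m ≥ 2 the dyadic entropy numbers of the embedding of the Sobolev space of mixed smoothness into the uniform norm satisfy e_m(I : W^r_p(𝕋^d) → L_∞(𝕋^d)) ≤ C m^{−r} (log m)^{(d−1)(1−r) + r}. -/

import Mathlib

open MeasureTheory Real
open scoped ENNReal ComplexConjugate Classical

noncomputable section

instance : Fact (0 < 2 * π) := ⟨by positivity⟩

/-- The `d`-dimensional torus `[0, 2π]^d`. -/
abbrev Torus (d : ℕ) := Fin d → AddCircle (2 * π)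

/-- The multivariate trigonometric character `x ↦ e^{i k · x}`. -/
def trigChar {d : ℕ} (k : Fin d → ℤ) : C(Torus d, ℂ) :=
  ⟨fun x => ∏ j, fourier (k j) (x j),
    continuous_finset_prod _ fun j _ => (map_continuous (fourier (k j))).comp (continuous_apply j)⟩

/-- The Fourier coefficient `f̂(k) = (2π)^{-d} ∫ f(x) e^{-i k·x} dx`. -/
def fCoeff {d : ℕ} (f : Torus d → ℂ) (k : Fin d → ℤ) : ℂ :=
  ((2 * π) ^ d)⁻¹ • ∫ x : Torus d, conj (trigChar k x) * f x

/-- The Fourier coefficients `F̂_{r,0}(k) = ∏_j |k_j|^{-r}` (with the convention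
`|0|^{-r} = 1`) of the multivariate Bernoulli kernel `F_{r,α}` for `α = 0`. -/
def wBern (d : ℕ) (r : ℝ) (k : Fin d → ℤ) : ℝ :=
  ∏ j, if k j = 0 then 1 else |(k j : ℝ)| ^ (-r)

/-- `f = F_{r,0} ∗ φ`, expressed through Fourier coefficients:
`f̂(k) = F̂_{r,0}(k) φ̂(k)` for all `k ∈ ℤ^d`. -/
def WRel (d : ℕ) (r : ℝ) (q : ℝ≥0∞) (f : Lp ℂ ∞ (volume : Measure (Torus d)))
    (φ : Lp ℂ q (volume : Measure (Torus d))) : Prop :=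
  ∀ k : Fin d → ℤ,
    fCoeff (f : Torus d → ℂ) k = (wBern d r k : ℂ) * fCoeff (φ : Torus d → ℂ) k

/-- The Sobolev space `W^r_p(𝕋^d)` of mixed smoothness: all `f = F_{r,0} ∗ φ` with
`φ ∈ L_p(𝕋^d)`, realized (for `r > 1/p`, via the embedding into `L_∞`) as a subset of
`L_∞(𝕋^d)`; it is normed by `‖f‖ := ‖φ‖_p`. -/
def WSpace (d : ℕ) (r : ℝ) (q : ℝ≥0∞) : Type :=
  {f : Lp ℂ ∞ (volume : Measure (Torus d)) //
    ∃ φ : Lp ℂ q (volume : Measure (Torus d)), WRel d r q f φ}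

noncomputable instance (d : ℕ) (r : ℝ) (q : ℝ≥0∞) : Norm (WSpace d r q) :=
  ⟨fun f => sInf {c : ℝ | ∃ φ : Lp ℂ q (volume : Measure (Torus d)),
    WRel d r q f.1 φ ∧ ‖φ‖ = c}⟩

/-- Dyadic entropy numbers. -/
noncomputable def eN {A B : Type*} [Norm A] [NormedAddCommGroup B]
    (T : A → B) (m : ℕ) : ℝ :=
  sInf {ε : ℝ | 0 < ε ∧ ∃ S : Finset B, S.card ≤ 2 ^ (m - 1) ∧
    ∀ a : A, ‖a‖ ≤ 1 → ∃ b ∈ S, ‖T a - b‖ ≤ ε}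

section DualSudakov

/-- The unnormalised Gaussian weight on a Euclidean space. -/
def gaussWeight {E : Type*} [NormedAddCommGroup E] (x : E) : ℝ≥0∞ :=
  ENNReal.ofReal (exp (-‖x‖ ^ 2 / 2))

lemma gaussWeight_neg {E : Type*} [NormedAddCommGroup E] (x : E) :
    gaussWeight (-x) = gaussWeight x := by simp [gaussWeight]

lemma measurable_gaussWeight {E : Type*} [NormedAddCommGroup E] [MeasurableSpace E]
    [BorelSpace E] : Measurable (gaussWeight : E → ℝ≥0∞) := by
  unfold gaussWeight
  fun_prop

variable {E : Type*} [NormedAddCommGroup E] [InnerProductSpace ℝ E]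

lemma two_mul_gaussWeight_le (x z : E) :
    2 * gaussWeight x ≤
      ENNReal.ofReal (exp (‖z‖ ^ 2 / 2)) * (gaussWeight (x + z) + gaussWeight (x - z)) := by
  unfold gaussWeight
  rw [← ENNReal.ofReal_add (by positivity) (by positivity), ← ENNReal.ofReal_mul (by positivity),
    show (2 : ℝ≥0∞) = ENNReal.ofReal 2 by simp, ← ENNReal.ofReal_mul (by positivity)]
  apply ENNReal.ofReal_le_ofReal
  have h1 : exp (‖z‖ ^ 2 / 2) * (exp (-‖x + z‖ ^ 2 / 2) + exp (-‖x - z‖ ^ 2 / 2)) =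
      exp (-‖x‖ ^ 2 / 2) * (2 * cosh (inner ℝ x z)) := by
    rw [cosh_eq, mul_div_cancel₀ _ (two_ne_zero), mul_add, mul_add, ← exp_add, ← exp_add,
      ← exp_add, ← exp_add, norm_add_sq_real, norm_sub_sq_real, add_comm]
    congr 2 <;> ring
  rw [h1, mul_comm]
  have := one_le_cosh (inner ℝ x z)
  gcongr
  linarith

variable [FiniteDimensional ℝ E] [MeasurableSpace E] [BorelSpace E]

/-- The unnormalised Gaussian measure on a Euclidean space. -/
def gaussVol (E : Type*) [NormedAddCommGroup E] [InnerProductSpace ℝ E] [FiniteDimensional ℝ E]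
    [MeasurableSpace E] [BorelSpace E] : Measure E :=
  (volume : Measure E).withDensity gaussWeight

lemma gaussVol_univ_ne_top : gaussVol E Set.univ ≠ ∞ := by
  rw [gaussVol, withDensity_apply _ MeasurableSet.univ, Measure.restrict_univ]
  have h := GaussianFourier.integrable_cexp_neg_mul_sq_norm_add (V := E) (b := (1 / 2 : ℂ))
    (by norm_num) 0 0
  have h2 := h.norm
  refine (lt_of_le_of_lt (le_of_eq ?_) h2.lintegral_lt_top).ne
  congr with x
  simp only [gaussWeight, Complex.norm_exp]
  congr 3
  simp [← Complex.ofReal_pow]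
  ring

lemma gaussVol_univ_ne_zero : gaussVol E Set.univ ≠ 0 := by
  rw [gaussVol, withDensity_apply _ MeasurableSet.univ, Measure.restrict_univ, Ne,
    lintegral_eq_zero_iff measurable_gaussWeight]
  intro h
  have : ∀ᵐ x : E, False := by
    filter_upwards [h] with x hx
    simp only [gaussWeight, Pi.zero_apply, ENNReal.ofReal_eq_zero] at hx
    exact absurd (exp_pos _) (not_lt.mpr hx)
  rw [ae_iff] at this
  simp only [not_false_eq_true, Set.ofPred_true] at this
  exact (isOpen_univ.measure_pos volume Set.univ_nonempty).ne' this

lemma gaussVol_halfSpace_le (a : E) (ha : ‖a‖ ≤ 1) (s : ℝ) (hs : 0 ≤ s) :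
    gaussVol E {x | s ≤ inner ℝ a x} ≤
      ENNReal.ofReal (exp (-s ^ 2 / 2)) * gaussVol E Set.univ := by
  have hm : MeasurableSet {x : E | s ≤ inner ℝ a x} :=
    measurableSet_le measurable_const (by fun_prop)
  have hsm : Measurable fun x : E => gaussWeight (x - s • a) :=
    measurable_gaussWeight.comp (measurable_sub_const _)
  rw [gaussVol, withDensity_apply _ MeasurableSet.univ, Measure.restrict_univ,
    withDensity_apply _ hm,
    ← lintegral_sub_right_eq_self (μ := (volume : Measure E)) gaussWeight (s • a),
    ← lintegral_const_mul _ hsm]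
  refine (setLIntegral_mono' hm fun x hx => ?_).trans (setLIntegral_le_lintegral _ _)
  unfold gaussWeight
  rw [← ENNReal.ofReal_mul (by positivity), ← exp_add]
  apply ENNReal.ofReal_le_ofReal
  rw [exp_le_exp, norm_sub_sq_real, inner_smul_right, norm_smul, norm_of_nonneg hs,
    real_inner_comm]
  have hx' : s ≤ inner ℝ a x := hx
  have h2 : ‖a‖ ^ 2 ≤ 1 := pow_le_one₀ (norm_nonneg _) ha
  nlinarith [mul_le_mul_of_nonneg_left hx' hs, mul_le_mul_of_nonneg_left h2 (sq_nonneg s)]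

lemma gaussVol_le_translate {K : Set E} (hK : MeasurableSet K) (hsymm : ∀ x ∈ K, -x ∈ K) (z : E) :
    gaussVol E K ≤ ENNReal.ofReal (exp (‖z‖ ^ 2 / 2)) * gaussVol E {x | x - z ∈ K} := by
  have hK' : MeasurableSet {x : E | x - z ∈ K} := (measurable_sub_const z) hK
  have e1 : gaussVol E {x | x - z ∈ K} = ∫⁻ x in K, gaussWeight (x + z) := by
    rw [gaussVol, withDensity_apply _ hK', ← lintegral_indicator hK', ← lintegral_indicator hK,
      ← lintegral_add_right_eq_self _ z]
    congr with x
    simp [Set.indicator]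
  have e2 : gaussVol E {x | x - z ∈ K} = ∫⁻ x in K, gaussWeight (x - z) := by
    rw [e1, ← lintegral_indicator hK, ← lintegral_indicator hK, ← lintegral_neg_eq_self]
    congr with x
    have : -x ∈ K ↔ x ∈ K := ⟨fun h => by simpa using hsymm _ h, hsymm x⟩
    simp only [Set.indicator, this]
    rw [← gaussWeight_neg]
    simp [add_comm, sub_eq_add_neg]
  have key : 2 * gaussVol E K ≤
      2 * (ENNReal.ofReal (exp (‖z‖ ^ 2 / 2)) * gaussVol E {x | x - z ∈ K}) := by
    calc 2 * gaussVol E K = ∫⁻ x in K, 2 * gaussWeight x := by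
          rw [gaussVol, withDensity_apply _ hK, lintegral_const_mul _ measurable_gaussWeight]
      _ ≤ ∫⁻ x in K, ENNReal.ofReal (exp (‖z‖ ^ 2 / 2)) *
            (gaussWeight (x + z) + gaussWeight (x - z)) :=
          lintegral_mono fun x => two_mul_gaussWeight_le x z
      _ = _ := by
          have m1 : Measurable fun x : E => gaussWeight (x + z) :=
            measurable_gaussWeight.comp (measurable_add_const z)
          have m2 : Measurable fun x : E => gaussWeight (x - z) :=
            measurable_gaussWeight.comp (measurable_sub_const z)
          rw [lintegral_const_mul _ (by exact m1.add m2), lintegral_add_left m1, ← e1, ← e2]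
          ring
  exact (ENNReal.mul_le_mul_iff_right (by simp) (by simp)).1 key

/-- If the translates `t • z + K`, `z ∈ F`, of a symmetric set of at least half Gaussian
measure are disjoint and `F` lies in the ball of radius `R`, then `F` is small. -/
lemma card_le_of_disjoint_translates {K : Set E} (hK : MeasurableSet K)
    (hsymm : ∀ x ∈ K, -x ∈ K) (hhalf : gaussVol E Set.univ ≤ 2 * gaussVol E K)
    (F : Finset E) (R : ℝ) (hF : ∀ z ∈ F, ‖z‖ ≤ R)
    (hdisj : (F : Set E).PairwiseDisjoint fun z => {x | x - z ∈ K}) :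
    (F.card : ℝ) ≤ 2 * exp (R ^ 2 / 2) := by
  have h1 : ∑ z ∈ F, gaussVol E {x | x - z ∈ K} ≤ gaussVol E Set.univ := by
    rw [← measure_biUnion_finset hdisj fun z _ => (measurable_sub_const z) hK]
    exact measure_mono (Set.subset_univ _)
  have h2 : (F.card : ℝ≥0∞) * gaussVol E Set.univ ≤
      ENNReal.ofReal (2 * exp (R ^ 2 / 2)) * gaussVol E Set.univ := by
    calc (F.card : ℝ≥0∞) * gaussVol E Set.univ = ∑ z ∈ F, gaussVol E Set.univ := by simp
      _ ≤ ∑ z ∈ F, ENNReal.ofReal (2 * exp (R ^ 2 / 2)) * gaussVol E {x | x - z ∈ K} := by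
          refine Finset.sum_le_sum fun z hz => hhalf.trans ?_
          rw [ENNReal.ofReal_mul (by norm_num), mul_assoc]
          simp only [ENNReal.ofReal_ofNat]
          gcongr
          refine (gaussVol_le_translate hK hsymm z).trans ?_
          gcongr
          exact hF z hz
      _ ≤ _ := by
          rw [← Finset.mul_sum]
          gcongr
  have h3 := (ENNReal.mul_le_mul_iff_left gaussVol_univ_ne_zero gaussVol_univ_ne_top).1 h2
  rw [← ENNReal.ofReal_natCast] at h3
  exact (ENNReal.ofReal_le_ofReal_iff (by positivity)).1 h3

lemma gaussVol_univ_le_two_mul {J : Type*} [Fintype J] [Nonempty J] (a : J → E)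
    (ha : ∀ j, ‖a j‖ ≤ 1) (s : ℝ) (hs : 0 ≤ s) (hs2 : s ^ 2 = 2 * log (4 * Fintype.card J)) :
    gaussVol E Set.univ ≤ 2 * gaussVol E {x | ∀ j, |inner ℝ (a j) x| < s} := by
  set K : Set E := {x | ∀ j, |inner ℝ (a j) x| < s} with hKdef
  have hJ : (0 : ℝ) < Fintype.card J := by exact_mod_cast Fintype.card_pos
  have hc : gaussVol E Kᶜ ≤ ENNReal.ofReal (1 / 2) * gaussVol E Set.univ := by
    have hsub : Kᶜ ⊆ ⋃ j, ({x | s ≤ inner ℝ (a j) x} ∪ {x | s ≤ inner ℝ (-a j) x}) := by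
      intro x hx
      simp only [hKdef, Set.mem_compl_iff, Set.mem_ofPred_eq, not_forall, not_lt] at hx
      obtain ⟨j, hj⟩ := hx
      refine Set.mem_iUnion.2 ⟨j, ?_⟩
      simp only [Set.mem_union, Set.mem_ofPred_eq, inner_neg_left]
      exact le_abs.1 hj
    refine (measure_mono hsub).trans ((measure_iUnion_fintype_le _ _).trans ?_)
    calc ∑ j, gaussVol E ({x | s ≤ inner ℝ (a j) x} ∪ {x | s ≤ inner ℝ (-a j) x})
        ≤ ∑ j : J, ENNReal.ofReal (1 / (2 * Fintype.card J)) * gaussVol E Set.univ := by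
          refine Finset.sum_le_sum fun j _ => (measure_union_le _ _).trans ?_
          have e : exp (-s ^ 2 / 2) = 1 / (4 * Fintype.card J) := by
            rw [hs2, show -(2 * log (4 * Fintype.card J)) / 2 = -log (4 * Fintype.card J) by ring,
              exp_neg, exp_log (by positivity), one_div]
          have h1 := gaussVol_halfSpace_le (a j) (ha j) s hs
          have h2 := gaussVol_halfSpace_le (-a j) (by simpa using ha j) s hs
          refine (add_le_add h1 h2).trans (le_of_eq ?_)
          rw [← add_mul, ← ENNReal.ofReal_add (by positivity) (by positivity), e]
          congr 2
          field_simp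
          norm_num
      _ = _ := by
          rw [Finset.sum_const, Finset.card_univ, nsmul_eq_mul, ← mul_assoc,
            ← ENNReal.ofReal_natCast, ← ENNReal.ofReal_mul (by positivity)]
          congr 2
          field_simp
  have hu : gaussVol E Set.univ ≤ gaussVol E K + gaussVol E Kᶜ := by
    rw [← Set.union_compl_self K]
    exact measure_union_le _ _
  have htop : gaussVol E Set.univ ≠ ∞ := gaussVol_univ_ne_top
  have hKtop : gaussVol E K ≠ ∞ := ne_top_of_le_ne_top htop (measure_mono (Set.subset_univ _))
  have h3 := hu.trans (add_le_add_right hc _)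
  rw [← ENNReal.toReal_le_toReal htop (by finiteness)] at h3 ⊢
  rw [ENNReal.toReal_add hKtop (by finiteness), ENNReal.toReal_mul,
    ENNReal.toReal_ofReal (by norm_num)] at h3
  rw [ENNReal.toReal_mul]
  simp only [ENNReal.toReal_ofNat]
  linarith

/-- Dual Sudakov bound: cardinality of separated sets with respect to a finite maximum of
functionals. -/
lemma card_le_of_separated {J : Type*} [Fintype J] [Nonempty J] (a : J → E) {A R ε : ℝ}
    (hA : 0 < A) (hε : 0 < ε) (ha : ∀ j, ‖a j‖ ≤ A) (F : Finset E)
    (hF : ∀ z ∈ F, ‖z‖ ≤ R)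
    (hsep : ∀ y ∈ F, ∀ z ∈ F, y ≠ z → ∃ j, ε < |inner ℝ (a j) (y - z)|) :
    (F.card : ℝ) ≤ 2 * exp (4 * (A * R / ε) ^ 2 * log (4 * Fintype.card J)) := by
  have hJ : (1 : ℝ) ≤ Fintype.card J := by exact_mod_cast Fintype.card_pos
  have hlog : 0 < log (4 * Fintype.card J) := log_pos (by linarith)
  set s := √(2 * log (4 * Fintype.card J)) with hs
  have hs0 : 0 < s := by positivity
  have hs2 : s ^ 2 = 2 * log (4 * Fintype.card J) := sq_sqrt (by positivity)
  set t := 2 * s * A / ε with ht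
  have ht0 : 0 < t := by positivity
  set b : J → E := fun j => A⁻¹ • a j with hb
  have hbn : ∀ j, ‖b j‖ ≤ 1 := fun j => by
    rw [hb, norm_smul, norm_inv, norm_of_nonneg hA.le, inv_mul_le_one₀ hA]
    exact ha j
  set K : Set E := {x | ∀ j, |inner ℝ (b j) x| < s} with hK
  have hKm : MeasurableSet K := by
    rw [hK, Set.ofPred_forall]
    exact MeasurableSet.iInter fun j => measurableSet_lt (by fun_prop) measurable_const
  have hinj : Function.Injective fun z : E => t • z := smul_right_injective E ht0.ne'
  have := card_le_of_disjoint_translates hKm (fun x hx j => by simpa using hx j)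
    (gaussVol_univ_le_two_mul b hbn s hs0.le hs2) (F.image fun z => t • z) (t * R)
    (fun z hz => by
      obtain ⟨y, hy, rfl⟩ := Finset.mem_image.1 hz
      rw [norm_smul, norm_of_nonneg ht0.le]
      exact mul_le_mul_of_nonneg_left (hF y hy) ht0.le)
    (by
      intro y' hy' z' hz' hne
      obtain ⟨y, hy, rfl⟩ := Finset.mem_image.1 hy'
      obtain ⟨z, hz, rfl⟩ := Finset.mem_image.1 hz'
      obtain ⟨j, hj⟩ := hsep y hy z hz fun h => hne (by rw [h])
      refine Set.disjoint_left.2 fun x hxy hxz => ?_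
      have h1 : |inner ℝ (b j) (x - t • y)| < s := hxy j
      have h2 : |inner ℝ (b j) (x - t • z)| < s := hxz j
      have h3 : t * (A⁻¹ * inner ℝ (a j) (y - z)) =
          inner ℝ (b j) (x - t • z) - inner ℝ (b j) (x - t • y) := by
        simp only [hb, inner_sub_right, inner_smul_right, real_inner_smul_left]
        ring
      have h4 : |t * (A⁻¹ * inner ℝ (a j) (y - z))| < 2 * s := by
        rw [h3]
        refine (abs_sub _ _).trans_lt (by linarith)
      rw [abs_mul, abs_mul, abs_of_pos ht0, abs_of_pos (inv_pos.2 hA)] at h4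
      have h5 : t * (A⁻¹ * ε) < 2 * s := lt_of_lt_of_le
        (mul_lt_mul_of_pos_left (mul_lt_mul_of_pos_left hj (inv_pos.2 hA)) ht0) h4.le
      have : t * (A⁻¹ * ε) = 2 * s := by rw [ht]; field_simp
      linarith)
  rw [Finset.card_image_of_injective _ hinj] at this
  refine this.trans (le_of_eq ?_)
  congr 2
  rw [ht, show (2 * s * A / ε * R) ^ 2 / 2 = s ^ 2 * (2 * (A * R / ε) ^ 2) by ring, hs2]
  ring

/-- Dual Sudakov bound: covering numbers of a Euclidean ball with respect to a finite maximum of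
functionals. -/
lemma exists_net {J : Type*} [Fintype J] [Nonempty J] (a : J → E) {A R ε : ℝ}
    (hA : 0 < A) (hε : 0 < ε) (ha : ∀ j, ‖a j‖ ≤ A) :
    ∃ F : Finset E, (∀ z ∈ F, ‖z‖ ≤ R) ∧
      (F.card : ℝ) ≤ 2 * exp (4 * (A * R / ε) ^ 2 * log (4 * Fintype.card J)) ∧
      ∀ y, ‖y‖ ≤ R → ∃ z ∈ F, ∀ j, |inner ℝ (a j) (y - z)| ≤ ε := by
  set P : Finset E → Prop := fun F => (∀ z ∈ F, ‖z‖ ≤ R) ∧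
    ∀ y ∈ F, ∀ z ∈ F, y ≠ z → ∃ j, ε < |inner ℝ (a j) (y - z)| with hP
  set M := 2 * exp (4 * (A * R / ε) ^ 2 * log (4 * Fintype.card J)) with hM
  have hbound : ∀ F, P F → F.card ≤ ⌊M⌋₊ := fun F hF =>
    Nat.le_floor (card_le_of_separated a hA hε ha F hF.1 hF.2)
  obtain ⟨F, hF, hmax⟩ : ∃ F, P F ∧ ∀ G, P G → G.card ≤ F.card := by
    have hne : ∃ n, ∃ F, P F ∧ F.card = n := ⟨0, ∅, by simp [hP], rfl⟩
    have hb : ∀ n, (∃ F, P F ∧ F.card = n) → n ≤ ⌊M⌋₊ := by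
      rintro n ⟨F, hF, rfl⟩
      exact hbound F hF
    obtain ⟨F, hF, hc⟩ := Nat.findGreatest_spec (P := fun n => ∃ F, P F ∧ F.card = n)
      (hb _ hne.choose_spec) hne.choose_spec
    refine ⟨F, hF, fun G hG => ?_⟩
    rw [hc]
    exact Nat.le_findGreatest (hbound G hG) ⟨G, hG, rfl⟩
  refine ⟨F, hF.1, card_le_of_separated a hA hε ha F hF.1 hF.2, fun y hy => ?_⟩
  by_contra! hcon
  have hyF : y ∉ F := fun h => by
    obtain ⟨j, hj⟩ := hcon y h
    simp at hj
    linarith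
  have := hmax (insert y F) ⟨by
    intro z hz
    rcases Finset.mem_insert.1 hz with rfl | hz
    exacts [hy, hF.1 z hz], by
    intro u hu v hv huv
    rcases Finset.mem_insert.1 hu with hu' | hu' <;> rcases Finset.mem_insert.1 hv with hv' | hv'
    · exact absurd (hu'.trans hv'.symm) huv
    · exact hu' ▸ hcon v hv'
    · obtain ⟨j, hj⟩ := hcon u hu'
      exact ⟨j, by rwa [hv', ← neg_sub, inner_neg_right, abs_neg]⟩
    · exact hF.2 u hu' v hv' huv⟩
  rw [Finset.card_insert_of_notMem hyF] at this
  omega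

end DualSudakov

section TorusFourier

variable {d : ℕ}

lemma trigChar_apply (k : Fin d → ℤ) (x : Torus d) :
    trigChar k x = ∏ j, fourier (k j) (x j) := rfl

lemma norm_trigChar_apply (k : Fin d → ℤ) (x : Torus d) : ‖trigChar k x‖ = 1 := by
  rw [trigChar_apply, norm_prod]
  exact Finset.prod_eq_one fun j _ => Circle.norm_coe _

lemma integral_fourier (n : ℤ) :
    ∫ x : AddCircle (2 * π), fourier n x = if n = 0 then (2 * π : ℂ) else 0 := by
  split_ifs with h
  · subst h
    simp [Measure.real, AddCircle.measure_univ, ENNReal.toReal_ofReal, pi_pos.le]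
  · exact integral_eq_zero_of_add_right_eq_neg (μ := volume)
      (fourier_add_half_inv_index h two_pi_pos)

lemma conj_trigChar_mul (k l : Fin d → ℤ) (x : Torus d) :
    conj (trigChar k x) * trigChar l x = ∏ j, fourier (l j - k j) (x j) := by
  simp only [trigChar_apply, map_prod, ← Finset.prod_mul_distrib, ← fourier_neg, ← fourier_add]
  refine Finset.prod_congr rfl fun j _ => ?_
  rw [neg_add_eq_sub]

lemma integral_conj_trigChar_mul (k l : Fin d → ℤ) :
    ∫ x : Torus d, conj (trigChar k x) * trigChar l x =
      if k = l then ((2 * π) ^ d : ℂ) else 0 := by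
  simp_rw [conj_trigChar_mul]
  rw [integral_fintype_prod_volume_eq_prod (fun j (t : AddCircle (2 * π)) => fourier (l j - k j) t)]
  simp_rw [integral_fourier]
  split_ifs with h
  · simp [h]
  · obtain ⟨j, hj⟩ := Function.ne_iff.1 h
    refine Finset.prod_eq_zero (Finset.mem_univ j) (if_neg fun h' => hj ?_)
    omega

lemma fCoeff_trigChar (k l : Fin d → ℤ) :
    fCoeff (trigChar l : Torus d → ℂ) k = if k = l then 1 else 0 := by
  unfold fCoeff
  rw [integral_conj_trigChar_mul]
  split_ifs
  · have : ((2 * π) ^ d : ℂ) = (((2 * π) ^ d : ℝ) : ℂ) := by push_cast; rfl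
    rw [this, Complex.real_smul, ← Complex.ofReal_mul, inv_mul_cancel₀ (by positivity)]
    simp
  · simp

lemma integrable_conj_trigChar_mul (k : Fin d → ℤ) {f : Torus d → ℂ} (hf : Integrable f) :
    Integrable fun x => conj (trigChar k x) * f x :=
  hf.bdd_mul (c := 1) (by fun_prop)
    (Filter.Eventually.of_forall fun x => by simp [norm_trigChar_apply])

lemma fCoeff_add {f g : Torus d → ℂ} (hf : Integrable f) (hg : Integrable g) (k : Fin d → ℤ) :
    fCoeff (fun x => f x + g x) k = fCoeff f k + fCoeff g k := by
  simp only [fCoeff, mul_add]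
  rw [integral_add (integrable_conj_trigChar_mul k hf) (integrable_conj_trigChar_mul k hg),
    smul_add]

lemma volume_real_torus : (volume : Measure (Torus d)).real Set.univ = (2 * π) ^ d := by
  rw [Measure.real, ← Set.pi_univ, volume_pi_pi]
  simp [AddCircle.measure_univ, ENNReal.toReal_ofReal, pi_pos.le]

/-- The Fourier coefficient as a continuous functional on continuous functions. -/
def fCoeffCLM (k : Fin d → ℤ) : C(Torus d, ℂ) →L[ℂ] ℂ :=
  LinearMap.mkContinuous
    { toFun := fun f => fCoeff f k
      map_add' := fun f g => fCoeff_add (f.continuous.integrable_of_hasCompactSupport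
        (HasCompactSupport.of_compactSpace _)) (g.continuous.integrable_of_hasCompactSupport
        (HasCompactSupport.of_compactSpace _)) k
      map_smul' := fun c f => by
        simp only [fCoeff, ContinuousMap.smul_apply, smul_eq_mul, RingHom.id_apply,
          mul_left_comm _ c]
        rw [integral_const_mul, Complex.real_smul, Complex.real_smul]
        ring } 1 fun f => by
    simp only [LinearMap.coe_mk, AddHom.coe_mk, fCoeff, one_mul]
    rw [norm_smul, norm_of_nonneg (by positivity : (0 : ℝ) ≤ ((2 * π) ^ d)⁻¹)]
    have := norm_integral_le_of_norm_le_const (μ := (volume : Measure (Torus d)))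
      (f := fun x => conj (trigChar k x) * f x) (C := ‖f‖)
      (Filter.Eventually.of_forall fun x => by
        simpa [norm_trigChar_apply] using f.norm_coe_le_norm x)
    rw [volume_real_torus] at this
    rw [inv_mul_le_iff₀ (by positivity)]
    exact this.trans_eq (mul_comm _ _)

lemma fCoeffCLM_apply (k : Fin d → ℤ) (f : C(Torus d, ℂ)) : fCoeffCLM k f = fCoeff f k := rfl

/-- Bessel's inequality. -/
lemma sum_norm_fCoeff_sq_le {h : Torus d → ℂ} (hh : MemLp h 2) (F : Finset (Fin d → ℤ)) :
    ∑ k ∈ F, ‖fCoeff h k‖ ^ 2 ≤ ((2 * π) ^ d)⁻¹ * ∫ x, ‖h x‖ ^ 2 := by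
  set c : ℝ := ((2 * π) ^ d)⁻¹ with hc
  have hc0 : 0 < c := by positivity
  set v : (Fin d → ℤ) → Lp ℂ 2 (volume : Measure (Torus d)) := fun k =>
    ((√c : ℝ) : ℂ) • ContinuousMap.toLp 2 volume ℂ (trigChar k) with hv
  have hcc : ((√c : ℝ) : ℂ) * ((√c : ℝ) : ℂ) = (c : ℂ) := by
    rw [← Complex.ofReal_mul, mul_self_sqrt hc0.le]
  have hon : Orthonormal ℂ v := by
    rw [orthonormal_iff_ite]
    intro k l
    simp only [hv, inner_smul_left, inner_smul_right, Complex.conj_ofReal]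
    rw [ContinuousMap.inner_toLp]
    simp_rw [mul_comm (trigChar l _)]
    rw [integral_conj_trigChar_mul, ← mul_assoc, hcc]
    split_ifs
    · rw [hc]
      push_cast
      exact inv_mul_cancel₀ (pow_ne_zero _ (by simp [pi_ne_zero]))
    · simp
  have hinner : ∀ k, inner ℂ (v k) (hh.toLp h) = ((√c : ℝ) : ℂ) * (((c⁻¹ : ℝ) : ℂ) * fCoeff h k) := by
    intro k
    simp only [hv, inner_smul_left, Complex.conj_ofReal]
    congr 1
    rw [fCoeff, ← hc, Complex.real_smul, ← mul_assoc, ← Complex.ofReal_mul, inv_mul_cancel₀ hc0.ne',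
      Complex.ofReal_one, one_mul, L2.inner_def]
    refine integral_congr_ae ?_
    filter_upwards [ContinuousMap.coeFn_toLp (p := 2) (𝕜 := ℂ) volume (trigChar k),
      hh.coeFn_toLp] with x h1 h2
    rw [h1, h2, RCLike.inner_apply, mul_comm]
  have hb := hon.sum_inner_products_le (hh.toLp h) (s := F)
  have hn : ‖hh.toLp h‖ ^ 2 = ∫ x, ‖h x‖ ^ 2 := by
    have h1 := @inner_self_eq_norm_sq_to_K ℂ _ _ _ _ (hh.toLp h)
    rw [L2.inner_def] at h1
    have h2 : ∫ x, inner ℂ (hh.toLp h x) (hh.toLp h x) = ((∫ x, ‖h x‖ ^ 2 : ℝ) : ℂ) := by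
      rw [← integral_complex_ofReal]
      refine integral_congr_ae ?_
      filter_upwards [hh.coeFn_toLp] with x h2
      rw [h2, inner_self_eq_norm_sq_to_K]
      simp
    rw [h2] at h1
    exact Complex.ofReal_injective (h1.trans (Complex.ofReal_pow _ _).symm).symm
  rw [hn] at hb
  have : ∀ k, ‖inner ℂ (v k) (hh.toLp h)‖ ^ 2 = c⁻¹ * ‖fCoeff h k‖ ^ 2 := by
    intro k
    rw [hinner, norm_mul, norm_mul, mul_pow, mul_pow, Complex.norm_real,
      Complex.norm_real, norm_inv, norm_of_nonneg hc0.le, norm_of_nonneg (sqrt_nonneg _), sq_sqrt hc0.le]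
    field_simp
  simp_rw [this, ← Finset.mul_sum] at hb
  rwa [inv_mul_le_iff₀ hc0] at hb

lemma trigChar_single (j : Fin d) (x : Torus d) :
    trigChar (Pi.single j 1) x = fourier 1 (x j) := by
  rw [trigChar_apply, Finset.prod_eq_single j]
  · simp
  · intro i _ hij
    simp [Pi.single_eq_of_ne hij]
  · simp

/-- The star subalgebra of trigonometric polynomials. -/
def trigSubalgebra (d : ℕ) : StarSubalgebra ℂ C(Torus d, ℂ) where
  toSubalgebra := Algebra.adjoin ℂ (Set.range trigChar)
  star_mem' := by
    change Algebra.adjoin ℂ (Set.range trigChar) ≤ star (Algebra.adjoin ℂ (Set.range trigChar))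
    refine Algebra.adjoin_le ?_
    rintro _ ⟨n, rfl⟩
    refine Algebra.subset_adjoin ⟨-n, ?_⟩
    ext1 x
    simp [trigChar_apply]

lemma trigSubalgebra_coe :
    (trigSubalgebra d).toSubalgebra.toSubmodule = Submodule.span ℂ (Set.range trigChar) := by
  apply Algebra.adjoin_eq_span_of_subset
  refine .trans (fun x ↦ Submonoid.closure_induction (fun _ ↦ id) ⟨0, ?_⟩ ?_)
    Submodule.subset_span
  · ext z
    simp [trigChar_apply]
  · rintro _ _ _ _ ⟨m, rfl⟩ ⟨n, rfl⟩
    refine ⟨m + n, ?_⟩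
    ext z
    simp [trigChar_apply, Finset.prod_mul_distrib]

lemma trigSubalgebra_separatesPoints : (trigSubalgebra d).SeparatesPoints := by
  intro x y hxy
  obtain ⟨i, hi⟩ := Function.ne_iff.1 hxy
  refine ⟨_, ⟨trigChar (Pi.single i 1), Algebra.subset_adjoin ⟨Pi.single i 1, rfl⟩, rfl⟩, ?_⟩
  dsimp only
  rw [trigChar_single, trigChar_single, fourier_one, fourier_one]
  exact fun h => hi (AddCircle.injective_toCircle two_pi_pos.ne' (Circle.coe_injective h))

lemma span_trigChar_topologicalClosure :
    (Submodule.span ℂ (Set.range (trigChar (d := d)))).topologicalClosure = ⊤ := by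
  rw [← trigSubalgebra_coe]
  exact congr_arg (Subalgebra.toSubmodule <| StarSubalgebra.toSubalgebra ·)
    (ContinuousMap.starSubalgebra_topologicalClosure_eq_top_of_separatesPoints _
      trigSubalgebra_separatesPoints)

lemma ae_eq_zero_of_fCoeff_eq_zero {f : Torus d → ℂ} (hf : MemLp f 2)
    (h : ∀ k, fCoeff f k = 0) : f =ᵐ[volume] 0 := by
  have hspan : (Submodule.span ℂ (Set.range fun k : Fin d → ℤ =>
      ContinuousMap.toLp 2 (volume : Measure (Torus d)) ℂ (trigChar k))).topologicalClosure
      = ⊤ := by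
    convert! (ContinuousMap.toLp_denseRange ℂ (volume : Measure (Torus d)) ℂ
      (p := 2) (by simp)).topologicalClosure_map_submodule span_trigChar_topologicalClosure
    rw [Submodule.map_span, ← Set.range_comp]
    rfl
  have hperp : ∀ g : Lp ℂ 2 (volume : Measure (Torus d)), inner ℂ g (hf.toLp f) = 0 := by
    intro g
    have hg : g ∈ (Submodule.span ℂ (Set.range fun k : Fin d → ℤ =>
      ContinuousMap.toLp 2 (volume : Measure (Torus d)) ℂ (trigChar k))).topologicalClosure := by
      rw [hspan]; trivial
    have hcl : IsClosed {g : Lp ℂ 2 (volume : Measure (Torus d)) | inner ℂ g (hf.toLp f) = 0} :=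
      isClosed_eq (by fun_prop) continuous_const
    refine closure_minimal ?_ hcl hg
    intro u hu
    induction hu using Submodule.span_induction with
    | mem u hu =>
      obtain ⟨k, rfl⟩ := hu
      have hk := h k
      rw [fCoeff, smul_eq_zero, or_iff_right (by positivity)] at hk
      simp only [Set.mem_ofPred_eq]
      rw [L2.inner_def, ← hk]
      refine integral_congr_ae ?_
      filter_upwards [ContinuousMap.coeFn_toLp (p := 2) (𝕜 := ℂ) volume (trigChar k),
        hf.coeFn_toLp] with x h1 h2
      rw [h1, h2, RCLike.inner_apply, mul_comm]
    | zero => simp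
    | add u v _ _ hu hv => simp_all [inner_add_left]
    | smul c u _ hu => simp_all [inner_smul_left]
  have h0 : hf.toLp f = 0 := inner_self_eq_zero.1 (hperp _)
  have h1 := hf.coeFn_toLp
  rw [h0] at h1
  exact h1.symm.trans (Lp.coeFn_zero _ _ _)

/-- A bounded function is determined by its Fourier coefficients. -/
lemma eq_toLp_of_fCoeff_eq (f : Lp ℂ ∞ (volume : Measure (Torus d))) (G : C(Torus d, ℂ))
    (h : ∀ k, fCoeff (f : Torus d → ℂ) k = fCoeff G k) :
    f = ContinuousMap.toLp ∞ volume ℂ G := by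
  have hf : MemLp (f : Torus d → ℂ) ∞ := Lp.memLp f
  have hG : MemLp (G : Torus d → ℂ) ∞ :=
    (memLp_congr_ae (ContinuousMap.coeFn_toLp (p := ∞) (𝕜 := ℂ) volume G)).1 (Lp.memLp _)
  have hsub : MemLp (fun x => (f : Torus d → ℂ) x + (-G : C(Torus d, ℂ)) x) ∞ := by
    exact (hf.sub hG).ae_eq (Filter.Eventually.of_forall fun x => by simp [sub_eq_add_neg])
  have hz := ae_eq_zero_of_fCoeff_eq_zero (hsub.mono_exponent le_top) fun k => by
    rw [fCoeff_add (hf.integrable le_top) (by exact (hG.integrable le_top).neg), h k,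
      ← fCoeffCLM_apply, ← fCoeffCLM_apply, map_neg, add_neg_cancel]
  refine Lp.ext ?_
  filter_upwards [hz, ContinuousMap.coeFn_toLp (p := ∞) (𝕜 := ℂ) volume G] with x h1 h2
  rw [h2]
  simpa [sub_eq_zero, ← sub_eq_add_neg] using h1

end TorusFourier

section DyadicDecomposition

/-- A piecewise linear cut-off: `1` on `(-∞, 1]` and `0` on `[2, ∞)`. -/
def vCut (x : ℝ) : ℝ := max 0 (min 1 (2 - x))

lemma vCut_nonneg (x : ℝ) : 0 ≤ vCut x := le_max_left _ _

lemma vCut_le_one (x : ℝ) : vCut x ≤ 1 := max_le zero_le_one (min_le_left _ _)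

lemma vCut_of_le {x : ℝ} (h : x ≤ 1) : vCut x = 1 := by
  rw [vCut, min_eq_left (by linarith), max_eq_right zero_le_one]

lemma vCut_of_ge {x : ℝ} (h : 2 ≤ x) : vCut x = 0 := by
  rw [vCut, max_eq_left ((min_le_right _ _).trans (by linarith))]

lemma vCut_anti {x y : ℝ} (h : x ≤ y) : vCut y ≤ vCut x :=
  max_le_max le_rfl (min_le_min le_rfl (by linarith))

lemma abs_vCut_sub_le (x y : ℝ) : |vCut x - vCut y| ≤ |x - y| := by
  unfold vCut
  refine (abs_max_sub_max_le_max _ _ _ _).trans (max_le (by simp) ?_)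
  refine (abs_min_sub_min_le_max _ _ _ _).trans (max_le (by simp) ?_)
  rw [show 2 - x - (2 - y) = -(x - y) by ring, abs_neg]

/-- The dyadic partition of unity on the integers. -/
def vDyad : ℕ → ℤ → ℝ
  | 0, k => vCut |(k : ℝ)|
  | s + 1, k => vCut (|(k : ℝ)| / 2 ^ (s + 1)) - vCut (|(k : ℝ)| / 2 ^ s)

lemma vDyad_nonneg (s : ℕ) (k : ℤ) : 0 ≤ vDyad s k := by
  cases s with
  | zero => exact vCut_nonneg _
  | succ s =>
    refine sub_nonneg.2 (vCut_anti ?_)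
    gcongr
    · norm_num
    · omega

lemma vDyad_le_one (s : ℕ) (k : ℤ) : vDyad s k ≤ 1 := by
  cases s with
  | zero => exact vCut_le_one _
  | succ s => exact (sub_le_self _ (vCut_nonneg _)).trans (vCut_le_one _)

lemma vDyad_eq_zero_of_ge {s : ℕ} {k : ℤ} (h : (2 : ℝ) ^ (s + 1) ≤ |(k : ℝ)|) :
    vDyad s k = 0 := by
  cases s with
  | zero => exact vCut_of_ge (by simpa using h)
  | succ s =>
    have h1 : (2 : ℝ) ≤ |(k : ℝ)| / 2 ^ (s + 1) := by
      rw [le_div_iff₀ (by positivity)]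
      simpa [pow_succ, mul_comm, mul_left_comm] using h
    have h2 : (2 : ℝ) ≤ |(k : ℝ)| / 2 ^ s :=
      h1.trans (by gcongr <;> norm_num)
    simp [vDyad, vCut_of_ge h1, vCut_of_ge h2]

lemma vDyad_succ_eq_zero_of_le {s : ℕ} {k : ℤ} (h : |(k : ℝ)| ≤ 2 ^ s) :
    vDyad (s + 1) k = 0 := by
  have h2 : |(k : ℝ)| / 2 ^ s ≤ 1 := div_le_one_of_le₀ h (by positivity)
  have h1 : |(k : ℝ)| / 2 ^ (s + 1) ≤ 1 :=
    le_trans (by gcongr <;> norm_num) h2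
  simp [vDyad, vCut_of_le h1, vCut_of_le h2]

lemma sum_vDyad (N : ℕ) (k : ℤ) :
    ∑ s ∈ Finset.range (N + 1), vDyad s k = vCut (|(k : ℝ)| / 2 ^ N) := by
  induction N with
  | zero => simp [vDyad]
  | succ N ih => rw [Finset.sum_range_succ, ih, vDyad]; ring

/-- The Fourier coefficients of the univariate Bernoulli kernel. -/
def qBern (r : ℝ) (k : ℤ) : ℝ := if k = 0 then 1 else |(k : ℝ)| ^ (-r)

lemma qBern_pos (r : ℝ) (k : ℤ) : 0 < qBern r k := by
  unfold qBern
  split_ifs with h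
  · exact one_pos
  · exact rpow_pos_of_pos (by positivity) _

lemma qBern_le_one {r : ℝ} (hr : 0 ≤ r) (k : ℤ) : qBern r k ≤ 1 := by
  unfold qBern
  split_ifs with h
  · exact le_rfl
  · exact rpow_le_one_of_one_le_of_nonpos (by exact_mod_cast Int.one_le_abs h) (by linarith)

lemma qBern_le_of_le {r x : ℝ} (hr : 0 ≤ r) (hx : 0 < x) {k : ℤ} (h : x ≤ |(k : ℝ)|) :
    qBern r k ≤ x ^ (-r) := by
  have hk : k ≠ 0 := by rintro rfl; simp at h; linarith
  rw [qBern, if_neg hk]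
  exact rpow_le_rpow_of_nonpos hx h (by linarith)

lemma abs_rpow_neg_sub_le {r x u v : ℝ} (hr : 0 ≤ r) (hr1 : r ≤ 1) (hx : 0 < x)
    (hu : x ≤ u) (hv : x ≤ v) : |u ^ (-r) - v ^ (-r)| ≤ x ^ (-r) * x⁻¹ * |u - v| := by
  wlog huv : u ≤ v generalizing u v
  · rw [abs_sub_comm, abs_sub_comm u]
    exact this hv hu (le_of_not_ge huv)
  have hu0 : 0 < u := hx.trans_le hu
  have hv0 : 0 < v := hx.trans_le hv
  have h1 : v ^ (-r) ≤ u ^ (-r) := rpow_le_rpow_of_nonpos hu0 huv (by linarith)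
  rw [abs_of_nonneg (by linarith), abs_of_nonpos (by linarith)]
  have h2 : u / v ≤ (u / v) ^ r := by
    simpa using rpow_le_rpow_of_exponent_ge (by positivity) (div_le_one_of_le₀ huv hv0.le) hr1
  have h3 : v ^ (-r) = u ^ (-r) * (u / v) ^ r := by
    rw [div_rpow hu0.le hv0.le, rpow_neg hu0.le, rpow_neg hv0.le]
    field_simp
  have h4 : 0 < u ^ (-r) := rpow_pos_of_pos hu0 _
  have h5 : u ^ (-r) ≤ x ^ (-r) := rpow_le_rpow_of_nonpos hx hu (by linarith)
  calc u ^ (-r) - v ^ (-r) ≤ u ^ (-r) * (1 - u / v) := by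
        rw [h3]; nlinarith
    _ = u ^ (-r) * v⁻¹ * (-(u - v)) := by field_simp; ring
    _ ≤ x ^ (-r) * x⁻¹ * (-(u - v)) := by
        have : 0 ≤ -(u - v) := by linarith
        gcongr

/-- Fourier coefficients of the dyadic pieces of the univariate Bernoulli kernel. -/
def bDyad (r : ℝ) (s : ℕ) (k : ℤ) : ℝ := qBern r k * vDyad s k

lemma bDyad_nonneg (r : ℝ) (s : ℕ) (k : ℤ) : 0 ≤ bDyad r s k :=
  mul_nonneg (qBern_pos r k).le (vDyad_nonneg s k)

lemma bDyad_eq_zero_of_ge {r : ℝ} {s : ℕ} {k : ℤ} (h : (2 : ℝ) ^ (s + 1) ≤ |(k : ℝ)|) :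
    bDyad r s k = 0 := by rw [bDyad, vDyad_eq_zero_of_ge h, mul_zero]

lemma two_rpow_le_of_le_one {r : ℝ} (hr1 : r ≤ 1) : (2 : ℝ) ^ r ≤ 2 := by
  simpa using rpow_le_rpow_of_exponent_le (one_le_two (α := ℝ)) hr1

lemma pow_rpow_neg (r : ℝ) (s : ℕ) : ((2 : ℝ) ^ s) ^ (-r) = 2 ^ (-r * s) := by
  rw [← rpow_natCast, ← rpow_mul zero_le_two, mul_comm]

lemma two_rpow_succ_neg {r : ℝ} (s : ℕ) :
    (2 : ℝ) ^ (-r * (s : ℝ)) = 2 ^ r * 2 ^ (-r * ((s + 1 : ℕ) : ℝ)) := by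
  rw [← rpow_add zero_lt_two]
  congr 1
  push_cast
  ring

lemma qBern_le_of_vDyad_ne_zero {r : ℝ} (hr : 0 ≤ r) (hr1 : r ≤ 1) {s : ℕ} {k : ℤ}
    (h : vDyad s k ≠ 0) : qBern r k ≤ 2 * 2 ^ (-r * (s : ℝ)) := by
  cases s with
  | zero => simpa using (qBern_le_one hr k).trans one_le_two
  | succ s =>
    have h1 : (2 : ℝ) ^ s ≤ |(k : ℝ)| := by
      contrapose! h
      exact vDyad_succ_eq_zero_of_le h.le
    refine (qBern_le_of_le hr (by positivity) h1).trans ?_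
    rw [pow_rpow_neg, two_rpow_succ_neg]
    gcongr
    exact two_rpow_le_of_le_one hr1

lemma bDyad_le {r : ℝ} (hr : 0 ≤ r) (hr1 : r ≤ 1) (s : ℕ) (k : ℤ) :
    bDyad r s k ≤ 2 * 2 ^ (-r * (s : ℝ)) := by
  by_cases h : vDyad s k = 0
  · rw [bDyad, h, mul_zero]; positivity
  · exact (mul_le_of_le_one_right (qBern_pos r k).le (vDyad_le_one s k)).trans
      (qBern_le_of_vDyad_ne_zero hr hr1 h)

lemma qBern_mul_bDyad_le {r : ℝ} (hr : 0 ≤ r) (hr1 : r ≤ 1) (s : ℕ) (k : ℤ) :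
    qBern r k * bDyad r s k ≤ (2 * 2 ^ (-r * (s : ℝ))) ^ 2 := by
  by_cases h : vDyad s k = 0
  · rw [bDyad, h, mul_zero, mul_zero]; positivity
  · have h1 := qBern_le_of_vDyad_ne_zero hr hr1 h
    rw [sq]
    exact mul_le_mul h1 (bDyad_le hr hr1 s k) (bDyad_nonneg _ _ _) (by positivity)

/-- The integers of modulus at most `M`. -/
abbrev symIcc (M : ℕ) : Finset ℤ := Finset.Icc (-(M : ℤ)) M

lemma notMem_symIcc {M : ℕ} {k : ℤ} (h : k ∉ symIcc M) : (M : ℝ) + 1 ≤ |(k : ℝ)| := by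
  have : (M : ℤ) + 1 ≤ |k| := by
    simp only [symIcc, Finset.mem_Icc, not_and_or] at h
    rcases h with h | h
    · rw [abs_of_nonpos (by omega)]; omega
    · rw [abs_of_nonneg (by omega)]; omega
  exact_mod_cast this

lemma card_symIcc (M : ℕ) : (symIcc M).card = 2 * M + 1 := by
  simp [symIcc]; omega

lemma card_symIcc_two_pow (s : ℕ) : ((symIcc (2 ^ (s + 1))).card : ℝ) ≤ 5 * 2 ^ s := by
  rw [card_symIcc]
  push_cast
  have : (1 : ℝ) ≤ 2 ^ s := one_le_pow₀ one_le_two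
  rw [pow_succ]
  linarith

lemma sum_qBern_mul_bDyad_le {r : ℝ} (hr : 0 ≤ r) (hr1 : r ≤ 1) (s : ℕ) (F : Finset ℤ) :
    ∑ k ∈ F, qBern r k * bDyad r s k ≤ 20 * 2 ^ ((1 - 2 * r) * (s : ℝ)) := by
  have h0 : ∀ k, 0 ≤ qBern r k * bDyad r s k := fun k =>
    mul_nonneg (qBern_pos r k).le (bDyad_nonneg _ _ _)
  calc ∑ k ∈ F, qBern r k * bDyad r s k
      ≤ ∑ k ∈ F ∪ symIcc (2 ^ (s + 1)), qBern r k * bDyad r s k :=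
        Finset.sum_le_sum_of_subset_of_nonneg Finset.subset_union_left fun k _ _ => h0 k
    _ = ∑ k ∈ symIcc (2 ^ (s + 1)), qBern r k * bDyad r s k := by
        symm
        refine Finset.sum_subset Finset.subset_union_right fun k _ hk => ?_
        have := notMem_symIcc hk
        push_cast at this
        rw [bDyad_eq_zero_of_ge (by linarith), mul_zero]
    _ ≤ (symIcc (2 ^ (s + 1))).card • (2 * 2 ^ (-r * (s : ℝ))) ^ 2 :=
        Finset.sum_le_card_nsmul _ _ _ fun k _ => qBern_mul_bDyad_le hr hr1 s k
    _ ≤ 5 * 2 ^ s * (2 * 2 ^ (-r * (s : ℝ))) ^ 2 := by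
        rw [nsmul_eq_mul]
        gcongr
        exact card_symIcc_two_pow s
    _ = 20 * 2 ^ ((1 - 2 * r) * (s : ℝ)) := by
        have : (2 : ℝ) ^ ((1 - 2 * r) * (s : ℝ)) = 2 ^ s * (2 ^ (-r * (s : ℝ))) ^ 2 := by
          rw [← rpow_natCast 2 s, ← rpow_natCast _ 2, ← rpow_mul zero_le_two,
            ← rpow_add zero_lt_two]
          congr 1
          push_cast
          ring
        rw [this]
        ring

lemma abs_vDyad_succ_sub_le (s : ℕ) (k : ℤ) :
    |vDyad (s + 1) k - vDyad (s + 1) (k - 1)| ≤ 3 / 2 * ((2 : ℝ) ^ s)⁻¹ := by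
  have h : |(|(k : ℝ)| - |((k - 1 : ℤ) : ℝ)|)| ≤ 1 := by
    refine (abs_abs_sub_abs_le _ _).trans ?_
    push_cast
    simp
  have key : ∀ t : ℕ, |vCut (|(k : ℝ)| / 2 ^ t) - vCut (|((k - 1 : ℤ) : ℝ)| / 2 ^ t)|
      ≤ ((2 : ℝ) ^ t)⁻¹ := by
    intro t
    refine (abs_vCut_sub_le _ _).trans ?_
    rw [← sub_div, abs_div, abs_of_pos (by positivity : (0 : ℝ) < 2 ^ t), div_eq_mul_inv]
    exact mul_le_of_le_one_left (by positivity) h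
  have h1 := key (s + 1)
  have h2 := key s
  rw [show ((2 : ℝ) ^ (s + 1))⁻¹ = (2 ^ s)⁻¹ * 2⁻¹ by rw [pow_succ, mul_inv]] at h1
  simp only [vDyad]
  rw [abs_le] at *
  constructor <;> linarith

lemma abs_bDyad_sub_le {r : ℝ} (hr : 0 ≤ r) (hr1 : r ≤ 1) (s : ℕ) (k : ℤ) :
    |bDyad r s k - bDyad r s (k - 1)| ≤ 10 * 2 ^ (-r * (s : ℝ)) * (2 ^ s)⁻¹ := by
  cases s with
  | zero =>
    have h1 := bDyad_le hr hr1 0 k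
    have h2 := bDyad_le hr hr1 0 (k - 1)
    have h3 := bDyad_nonneg r 0 k
    have h4 := bDyad_nonneg r 0 (k - 1)
    simp only [Nat.cast_zero, mul_zero, rpow_zero, pow_zero, inv_one, mul_one] at *
    rw [abs_le]
    constructor <;> linarith
  | succ s =>
    by_cases h0 : vDyad (s + 1) k = 0 ∧ vDyad (s + 1) (k - 1) = 0
    · rw [bDyad, bDyad, h0.1, h0.2, mul_zero, mul_zero, sub_zero, abs_zero]
      positivity
    have hk : (2 : ℝ) ^ s ≤ |(k : ℝ)| ∧ (2 : ℝ) ^ s ≤ |((k - 1 : ℤ) : ℝ)| := by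
      have h1 : (2 : ℤ) ^ s < |k| ∨ (2 : ℤ) ^ s < |k - 1| := by
        by_contra! hc
        refine h0 ⟨vDyad_succ_eq_zero_of_le ?_, vDyad_succ_eq_zero_of_le ?_⟩
        · exact_mod_cast hc.1
        · exact_mod_cast hc.2
      have h2 : (2 : ℤ) ^ s ≤ |k| ∧ (2 : ℤ) ^ s ≤ |k - 1| := by
        generalize (2 : ℤ) ^ s = N at h1
        rcases abs_cases k with h | h <;> rcases abs_cases (k - 1) with h' | h' <;> omega
      exact ⟨by exact_mod_cast h2.1, by exact_mod_cast h2.2⟩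
    set x : ℝ := 2 ^ s with hx
    have hx0 : 0 < x := by positivity
    have hk0 : k ≠ 0 := by
      rintro rfl
      have := hk.1
      simp at this
      linarith
    have hk1 : k - 1 ≠ 0 := by
      intro h
      have := hk.2
      rw [h] at this
      simp at this
      linarith
    have h1 : |qBern r k - qBern r (k - 1)| ≤ x ^ (-r) * x⁻¹ := by
      rw [qBern, qBern, if_neg hk0, if_neg hk1]
      refine (abs_rpow_neg_sub_le hr hr1 hx0 hk.1 hk.2).trans ?_
      refine mul_le_of_le_one_right (by positivity) ?_
      refine (abs_abs_sub_abs_le _ _).trans ?_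
      push_cast
      simp
    have h2 : qBern r (k - 1) ≤ x ^ (-r) := qBern_le_of_le hr hx0 hk.2
    have h3 := abs_vDyad_succ_sub_le s k
    rw [← hx] at h3
    have h4 : x ^ (-r) * x⁻¹ ≤ 4 * 2 ^ (-r * ((s + 1 : ℕ) : ℝ)) * (2 ^ (s + 1))⁻¹ := by
      rw [hx, pow_rpow_neg, two_rpow_succ_neg, pow_succ, mul_inv]
      have := two_rpow_le_of_le_one hr1
      have h5 : (0 : ℝ) < 2 ^ (-r * ((s + 1 : ℕ) : ℝ)) * ((2 : ℝ) ^ s)⁻¹ := by positivity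
      nlinarith
    have h6 : bDyad r (s + 1) k - bDyad r (s + 1) (k - 1) =
        (qBern r k - qBern r (k - 1)) * vDyad (s + 1) k +
          qBern r (k - 1) * (vDyad (s + 1) k - vDyad (s + 1) (k - 1)) := by
      unfold bDyad; ring
    rw [h6]
    calc _ ≤ |qBern r k - qBern r (k - 1)| * |vDyad (s + 1) k| +
          |qBern r (k - 1)| * |vDyad (s + 1) k - vDyad (s + 1) (k - 1)| := by
          rw [← abs_mul, ← abs_mul]; exact abs_add_le _ _
      _ ≤ x ^ (-r) * x⁻¹ * 1 + x ^ (-r) * (3 / 2 * x⁻¹) := by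
          rw [abs_of_nonneg (vDyad_nonneg _ _), abs_of_pos (qBern_pos _ _)]
          gcongr
          · exact vDyad_nonneg _ _
          · exact vDyad_le_one _ _
      _ ≤ 10 * 2 ^ (-r * ((s + 1 : ℕ) : ℝ)) * (2 ^ (s + 1))⁻¹ := by
          linarith

end DyadicDecomposition

section DyadicKernels

lemma integrable_of_continuous_of_compact {X E : Type*} [TopologicalSpace X] [CompactSpace X]
    [MeasurableSpace X] [OpensMeasurableSpace X] [NormedAddCommGroup E]
    {μ : Measure X} [IsFiniteMeasureOnCompacts μ] {f : X → E} (hf : Continuous f) :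
    Integrable f μ :=
  hf.integrable_of_hasCompactSupport (HasCompactSupport.of_compactSpace _)

lemma integral_norm_sum_fourier_sq (F : Finset ℤ) (c : ℤ → ℝ) :
    ∫ t : AddCircle (2 * π), ‖∑ k ∈ F, (c k : ℂ) * fourier k t‖ ^ 2 =
      2 * π * ∑ k ∈ F, c k ^ 2 := by
  refine Complex.ofReal_injective ?_
  rw [← integral_complex_ofReal]
  have h : ∀ t : AddCircle (2 * π),
      ((‖∑ k ∈ F, (c k : ℂ) * fourier k t‖ ^ 2 : ℝ) : ℂ) =
        ∑ k ∈ F, ∑ l ∈ F, (c k * c l : ℂ) * fourier (l - k) t := by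
    intro t
    rw [Complex.ofReal_pow, ← Complex.conj_mul', map_sum, Finset.sum_mul_sum]
    refine Finset.sum_congr rfl fun k _ => Finset.sum_congr rfl fun l _ => ?_
    rw [map_mul, Complex.conj_ofReal, ← fourier_neg, sub_eq_neg_add, fourier_add]
    ring
  simp_rw [h]
  rw [integral_finsetSum _ fun k _ => integrable_of_continuous_of_compact (by fun_prop)]
  simp_rw [fun k => integral_finsetSum (μ := (volume : Measure (AddCircle (2 * π)))) F
    (f := fun l t => (c k * c l : ℂ) * fourier (l - k) t)
    fun l _ => integrable_of_continuous_of_compact (by fun_prop), integral_const_mul,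
    integral_fourier, sub_eq_zero]
  simp only [mul_ite, mul_zero, Finset.sum_ite_eq']
  rw [Finset.sum_congr rfl fun k hk => if_pos hk]
  push_cast
  rw [Finset.mul_sum]
  exact Finset.sum_congr rfl fun k _ => by ring

lemma norm_fourier_one_sub_one {t : ℝ} (ht : |t| ≤ π) :
    2 / π * |t| ≤ ‖fourier 1 (t : AddCircle (2 * π)) - 1‖ := by
  have h : fourier 1 (t : AddCircle (2 * π)) = Complex.exp (Complex.I * t) := by
    rw [fourier_coe_apply]
    congr 1
    have : (π : ℂ) ≠ 0 := by simp [pi_ne_zero]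
    push_cast
    field_simp
  rw [h, Complex.norm_exp_I_mul_ofReal_sub_one, norm_mul, norm_eq_abs, norm_eq_abs]
  have h1 := mul_abs_le_abs_sin (x := t / 2) (by rw [abs_div, abs_two]; linarith)
  rw [abs_div, abs_two] at h1
  rw [abs_two]
  linarith

lemma integral_inv_one_add_le {R : ℝ} (hR : 0 < R) :
    ∫ t : AddCircle (2 * π), (1 + R ^ 2 * ‖fourier 1 t - 1‖ ^ 2)⁻¹ ≤ π ^ 2 / (2 * R) := by
  rw [← AddCircle.intervalIntegral_preimage (2 * π) (-π), show -π + 2 * π = π by ring]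
  set g : ℝ → ℝ := fun x => (1 + x ^ 2)⁻¹ with hg
  have hc : 0 < 2 * R / π := by positivity
  have hgi : Integrable fun t => g (2 * R / π * t) :=
    integrable_inv_one_add_sq.comp_mul_left' hc.ne'
  have hcont : Continuous fun t : ℝ =>
      (1 + R ^ 2 * ‖fourier 1 (t : AddCircle (2 * π)) - 1‖ ^ 2)⁻¹ := by
    refine Continuous.inv₀ ?_ fun t => by positivity
    have : Continuous fun t : ℝ => fourier 1 (t : AddCircle (2 * π)) :=
      (map_continuous (fourier 1)).comp (AddCircle.continuous_mk' _)
    fun_prop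
  calc _ ≤ ∫ t in (-π)..π, g (2 * R / π * t) := by
        refine intervalIntegral.integral_mono_on (by linarith [pi_pos])
          (hcont.intervalIntegrable _ _) hgi.intervalIntegrable fun t ht => ?_
        have h1 := norm_fourier_one_sub_one (abs_le.2 ht)
        have h2 : (2 * R / π * t) ^ 2 ≤ R ^ 2 * ‖fourier 1 (t : AddCircle (2 * π)) - 1‖ ^ 2 := by
          rw [show (2 * R / π * t) ^ 2 = R ^ 2 * (2 / π * |t|) ^ 2 by
            rw [mul_pow (2 / π), sq_abs]; ring]
          gcongr
        exact inv_anti₀ (by positivity) (by linarith)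
    _ ≤ ∫ t, g (2 * R / π * t) := by
        rw [intervalIntegral.integral_of_le (by linarith [pi_pos])]
        exact setIntegral_le_integral hgi (Filter.Eventually.of_forall fun t => by
          simp only [hg]; positivity)
    _ = π ^ 2 / (2 * R) := by
        rw [Measure.integral_comp_mul_left, integral_univ_inv_one_add_sq,
          abs_of_pos (by positivity)]
        simp only [smul_eq_mul]
        field_simp

lemma fourier_one_sub_one_mul_sum {c : ℤ → ℝ} {M : ℕ} (hc : ∀ k : ℤ, (M : ℝ) ≤ |(k : ℝ)| → c k = 0)
    (t : AddCircle (2 * π)) :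
    (fourier 1 t - 1) * ∑ k ∈ symIcc M, (c k : ℂ) * fourier k t =
      -∑ k ∈ symIcc M, ((c k - c (k - 1) : ℝ) : ℂ) * fourier k t := by
  have h : ∑ k ∈ symIcc M, (c k : ℂ) * fourier (k + 1) t =
      ∑ k ∈ symIcc M, (c (k - 1) : ℂ) * fourier k t := by
    have h1 : ∑ k ∈ symIcc M, (c (k - 1) : ℂ) * fourier k t =
        ∑ k ∈ Finset.Icc (-(M : ℤ) + 1) (M + 1), (c (k - 1) : ℂ) * fourier k t := by
      rw [Finset.sum_subset (s₂ := Finset.Icc (-(M : ℤ)) (M + 1)),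
        ← Finset.sum_subset (s₁ := Finset.Icc (-(M : ℤ) + 1) (M + 1))
          (s₂ := Finset.Icc (-(M : ℤ)) (M + 1))]
      · exact Finset.Icc_subset_Icc (by omega) le_rfl
      · intro k hk hk'
        simp only [Finset.mem_Icc] at hk hk'
        have : k = -(M : ℤ) := by omega
        rw [hc, Complex.ofReal_zero, zero_mul]
        subst this
        push_cast
        rw [← abs_neg, neg_sub, sub_neg_eq_add, abs_of_nonneg (by positivity)]
        linarith
      · exact Finset.Icc_subset_Icc le_rfl (by omega)
      · intro k hk hk'
        simp only [symIcc, Finset.mem_Icc] at hk hk'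
        have : k = (M : ℤ) + 1 := by omega
        rw [hc, Complex.ofReal_zero, zero_mul]
        subst this
        simp
    rw [h1, ← Finset.image_add_right_Icc, Finset.sum_image fun a _ b _ h => by simpa using h]
    simp
  have h2 : (fourier 1 t - 1) * ∑ k ∈ symIcc M, (c k : ℂ) * fourier k t =
      ∑ k ∈ symIcc M, (c k : ℂ) * fourier (k + 1) t -
        ∑ k ∈ symIcc M, (c k : ℂ) * fourier k t := by
    rw [sub_mul, one_mul, Finset.mul_sum]
    congr 1
    refine Finset.sum_congr rfl fun k _ => ?_
    rw [fourier_add]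
    ring
  rw [h2, h, ← Finset.sum_sub_distrib, ← Finset.sum_neg_distrib]
  refine Finset.sum_congr rfl fun k _ => ?_
  push_cast
  ring

lemma integral_norm_sum_fourier_le {c : ℤ → ℝ} {M : ℕ} {B L R θ : ℝ}
    (hc : ∀ k : ℤ, (M : ℝ) ≤ |(k : ℝ)| → c k = 0) (hB : ∀ k, |c k| ≤ B)
    (hL : ∀ k, |c k - c (k - 1)| ≤ L) (hR : 0 < R) (hθ : 0 < θ) :
    ∫ t : AddCircle (2 * π), ‖∑ k ∈ symIcc M, (c k : ℂ) * fourier k t‖ ≤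
      θ * (2 * π * ((symIcc M).card * (B ^ 2 + R ^ 2 * L ^ 2))) + θ⁻¹ * (π ^ 2 / (2 * R)) := by
  set b : AddCircle (2 * π) → ℂ := fun t => ∑ k ∈ symIcc M, (c k : ℂ) * fourier k t with hb
  set b' : AddCircle (2 * π) → ℂ :=
    fun t => ∑ k ∈ symIcc M, ((c k - c (k - 1) : ℝ) : ℂ) * fourier k t with hb'
  have hbc : Continuous b := by fun_prop
  have hbc' : Continuous b' := by fun_prop
  set w : AddCircle (2 * π) → ℝ := fun t => 1 + R ^ 2 * ‖fourier 1 t - 1‖ ^ 2 with hw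
  have hwc : Continuous w := by fun_prop
  have hw0 : ∀ t, 0 < w t := fun t => by simp only [hw]; positivity
  have hwi : Continuous fun t => (w t)⁻¹ := hwc.inv₀ fun t => (hw0 t).ne'
  have hpt : ∀ t, ‖b t‖ ≤ θ * (‖b t‖ ^ 2 + R ^ 2 * ‖b' t‖ ^ 2) + θ⁻¹ * (w t)⁻¹ := by
    intro t
    have h1 : ‖b t‖ ^ 2 + R ^ 2 * ‖b' t‖ ^ 2 = ‖b t‖ ^ 2 * w t := by
      have : ‖b' t‖ = ‖fourier 1 t - 1‖ * ‖b t‖ := by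
        rw [← norm_mul, hb, fourier_one_sub_one_mul_sum hc, norm_neg]
      rw [this, hw]; ring
    rw [h1]
    have h2 := hw0 t
    have h3 : 0 ≤ θ⁻¹ * (w t)⁻¹ * (θ * w t * ‖b t‖ - 1) ^ 2 := by positivity
    have h4 : θ⁻¹ * (w t)⁻¹ * (θ * w t * ‖b t‖ - 1) ^ 2 =
        θ * (‖b t‖ ^ 2 * w t) + θ⁻¹ * (w t)⁻¹ - 2 * ‖b t‖ := by
      field_simp
      ring
    have := norm_nonneg (b t)
    linarith
  have hsum : ∀ (e : ℤ → ℝ) (E : ℝ), (∀ k, |e k| ≤ E) →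
      ∑ k ∈ symIcc M, e k ^ 2 ≤ (symIcc M).card * E ^ 2 := by
    intro e E he
    rw [← nsmul_eq_mul]
    exact Finset.sum_le_card_nsmul _ _ _ fun k _ =>
      sq_le_sq.2 ((he k).trans (le_abs_self _))
  calc ∫ t, ‖b t‖ ≤ ∫ t, (θ * (‖b t‖ ^ 2 + R ^ 2 * ‖b' t‖ ^ 2) + θ⁻¹ * (w t)⁻¹) :=
        integral_mono (integrable_of_continuous_of_compact (by fun_prop))
          (integrable_of_continuous_of_compact (by fun_prop)) hpt
    _ = θ * ((∫ t, ‖b t‖ ^ 2) + R ^ 2 * ∫ t, ‖b' t‖ ^ 2) + θ⁻¹ * ∫ t, (w t)⁻¹ := by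
        rw [integral_add (integrable_of_continuous_of_compact (by fun_prop))
          (integrable_of_continuous_of_compact (by fun_prop)), integral_const_mul,
          integral_const_mul, integral_add (integrable_of_continuous_of_compact (by fun_prop))
          (integrable_of_continuous_of_compact (by fun_prop)), integral_const_mul]
    _ ≤ θ * (2 * π * ((symIcc M).card * B ^ 2) +
          R ^ 2 * (2 * π * ((symIcc M).card * L ^ 2))) + θ⁻¹ * (π ^ 2 / (2 * R)) := by
        rw [integral_norm_sum_fourier_sq, integral_norm_sum_fourier_sq]
        gcongr
        · exact hsum _ _ hB
        · exact hsum _ _ hL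
        · exact integral_inv_one_add_le hR
    _ = _ := by ring

/-- The dyadic pieces of the univariate Bernoulli kernel. -/
def bKer (r : ℝ) (s : ℕ) (t : AddCircle (2 * π)) : ℂ :=
  ∑ k ∈ symIcc (2 ^ (s + 1)), (bDyad r s k : ℂ) * fourier k t

lemma continuous_bKer (r : ℝ) (s : ℕ) : Continuous (bKer r s) := by
  unfold bKer; fun_prop

lemma integral_norm_bKer_le {r : ℝ} (hr : 0 ≤ r) (hr1 : r ≤ 1) (s : ℕ) :
    ∫ t, ‖bKer r s t‖ ≤ 5000 * 2 ^ (-r * (s : ℝ)) := by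
  set ρ : ℝ := 2 ^ (-r * (s : ℝ)) with hρ
  have hρ0 : 0 < ρ := by positivity
  have hs : (0 : ℝ) < 2 ^ s := by positivity
  have h := integral_norm_sum_fourier_le (c := bDyad r s) (M := 2 ^ (s + 1)) (B := 2 * ρ)
    (L := 10 * ρ * (2 ^ s)⁻¹) (R := 2 ^ s) (θ := (2 ^ s * ρ)⁻¹)
    (fun k hk => bDyad_eq_zero_of_ge (by exact_mod_cast hk))
    (fun k => by rw [abs_of_nonneg (bDyad_nonneg _ _ _)]; exact bDyad_le hr hr1 s k)
    (fun k => abs_bDyad_sub_le hr hr1 s k) hs (by positivity)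
  refine h.trans ?_
  have h2 : (2 ^ s * ρ)⁻¹ * (2 * π * ((symIcc (2 ^ (s + 1))).card *
      ((2 * ρ) ^ 2 + (2 ^ s) ^ 2 * (10 * ρ * (2 ^ s)⁻¹) ^ 2))) ≤
      (2 ^ s * ρ)⁻¹ * (2 * 3.15 * (5 * 2 ^ s *
      ((2 * ρ) ^ 2 + (2 ^ s) ^ 2 * (10 * ρ * (2 ^ s)⁻¹) ^ 2))) := by
    gcongr
    · exact pi_lt_d2.le
    · exact card_symIcc_two_pow s
  have h3 : (2 ^ s * ρ)⁻¹ * (2 * 3.15 * (5 * 2 ^ s *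
      ((2 * ρ) ^ 2 + (2 ^ s) ^ 2 * (10 * ρ * (2 ^ s)⁻¹) ^ 2))) = 3276 * ρ := by
    field_simp
    norm_num
  have h4 : ((2 ^ s * ρ)⁻¹)⁻¹ * (π ^ 2 / (2 * 2 ^ s)) = π ^ 2 / 2 * ρ := by
    field_simp
  have h5 : π ^ 2 ≤ 16 := by nlinarith [pi_le_four, pi_pos]
  rw [h4]
  nlinarith

end DyadicKernels

section Layers

/-- Multi-indices `s` with `∑ s_j = n`. -/
abbrev layerIdx (d n : ℕ) : Finset (Fin d → ℕ) := Finset.piAntidiag Finset.univ n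

lemma mem_layerIdx {d n : ℕ} {s : Fin d → ℕ} : s ∈ layerIdx d n ↔ ∑ j, s j = n := by
  simp [layerIdx]

lemma le_of_mem_layerIdx {d n : ℕ} {s : Fin d → ℕ} (hs : s ∈ layerIdx d n) (j : Fin d) :
    s j ≤ n := by
  rw [← mem_layerIdx.1 hs]
  exact Finset.single_le_sum (f := s) (fun _ _ => Nat.zero_le _) (Finset.mem_univ j)

lemma card_layerIdx_le (D n : ℕ) : (layerIdx (D + 1) n).card ≤ (n + 1) ^ D := by
  have h : (Fintype.piFinset fun _ : Fin D => Finset.range (n + 1)).card = (n + 1) ^ D := by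
    simp
  rw [← h]
  refine Finset.card_le_card_of_injOn Fin.tail ?_ ?_
  · intro s hs
    rw [Finset.mem_coe, Fintype.mem_piFinset]
    exact fun j => Finset.mem_range_succ_iff.2 (le_of_mem_layerIdx hs _)
  · intro s hs t ht hst
    have h1 := mem_layerIdx.1 hs
    have h2 := mem_layerIdx.1 ht
    rw [Fin.sum_univ_succ] at h1 h2
    have h3 : ∀ j : Fin D, s j.succ = t j.succ := fun j => congrFun hst j
    simp_rw [h3] at h1
    funext j
    refine Fin.cases ?_ h3 j
    omega

/-- The coefficients of the `n`-th layer of the Bernoulli kernel. -/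
def cLay {d : ℕ} (r : ℝ) (n : ℕ) (k : Fin d → ℤ) : ℝ :=
  ∑ s ∈ layerIdx d n, ∏ j, bDyad r (s j) (k j)

variable {d : ℕ} {r : ℝ}

lemma cLay_nonneg (r : ℝ) (n : ℕ) (k : Fin d → ℤ) : 0 ≤ cLay r n k :=
  Finset.sum_nonneg fun _ _ => Finset.prod_nonneg fun _ _ => bDyad_nonneg _ _ _

lemma cLay_eq_sum_filter (r : ℝ) (n : ℕ) {k : Fin d → ℤ} {T : ℕ}
    (hT : ∀ j, |(k j : ℝ)| ≤ 2 ^ T) :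
    cLay r n k = ∑ s ∈ Fintype.piFinset (fun _ : Fin d => Finset.range (T + 1)) with
      ∑ j, s j = n, ∏ j, bDyad r (s j) (k j) := by
  symm
  refine Finset.sum_subset ?_ ?_
  · intro s hs
    exact mem_layerIdx.2 (Finset.mem_filter.1 hs).2
  · intro s hs hs'
    simp only [Finset.mem_filter, Fintype.mem_piFinset, mem_layerIdx.1 hs, and_true,
      not_forall, Finset.mem_range, not_lt] at hs'
    obtain ⟨j, hj⟩ := hs'
    refine Finset.prod_eq_zero (Finset.mem_univ j) ?_
    obtain ⟨t, ht⟩ : ∃ t, s j = t + 1 := ⟨s j - 1, by omega⟩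
    rw [ht, bDyad, vDyad_succ_eq_zero_of_le, mul_zero]
    exact (hT j).trans (pow_le_pow_right₀ one_le_two (by omega))

lemma exists_two_pow_ge (k : Fin d → ℤ) : ∃ T : ℕ, ∀ j, |(k j : ℝ)| ≤ 2 ^ T := by
  refine ⟨∑ j, (k j).natAbs, fun j => ?_⟩
  have h1 : (k j).natAbs ≤ ∑ j, (k j).natAbs :=
    Finset.single_le_sum (f := fun j => (k j).natAbs) (fun _ _ => Nat.zero_le _)
      (Finset.mem_univ j)
  have h2 : (k j).natAbs ≤ 2 ^ ∑ j, (k j).natAbs := h1.trans Nat.lt_two_pow_self.le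
  have h3 : |(k j : ℝ)| = ((k j).natAbs : ℝ) := by
    rw [Nat.cast_natAbs, Int.cast_abs]
  rw [h3]
  exact_mod_cast h2

lemma hasSum_cLay (r : ℝ) (k : Fin d → ℤ) : HasSum (fun n => cLay r n k) (wBern d r k) := by
  obtain ⟨T, hT⟩ := exists_two_pow_ge k
  have h : ∑ n ∈ Finset.range (d * T + 1), cLay r n k = wBern d r k := by
    simp_rw [cLay_eq_sum_filter r _ hT]
    rw [Finset.sum_fiberwise_of_maps_to,
      ← Finset.prod_univ_sum (fun _ => Finset.range (T + 1)) fun j t => bDyad r t (k j)]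
    · refine Finset.prod_congr rfl fun j _ => ?_
      simp_rw [bDyad]
      rw [← Finset.mul_sum, sum_vDyad,
        vCut_of_le (div_le_one_of_le₀ (hT j) (by positivity)), mul_one, qBern]
    · intro s hs
      rw [Fintype.mem_piFinset] at hs
      rw [Finset.mem_range_succ_iff]
      calc ∑ j, s j ≤ ∑ _j : Fin d, T :=
            Finset.sum_le_sum fun j _ => Finset.mem_range_succ_iff.1 (hs j)
        _ = d * T := by simp
  rw [← h]
  refine hasSum_sum_of_ne_finset_zero fun n hn => ?_
  rw [cLay_eq_sum_filter r n hT]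
  refine Finset.sum_eq_zero fun s hs => absurd hn (not_not.2 ?_)
  rw [Finset.mem_filter, Fintype.mem_piFinset] at hs
  rw [Finset.mem_range_succ_iff, ← hs.2]
  calc ∑ j, s j ≤ ∑ _j : Fin d, T :=
        Finset.sum_le_sum fun j _ => Finset.mem_range_succ_iff.1 (hs.1 j)
    _ = d * T := by simp

lemma cLay_le_wBern (r : ℝ) (n : ℕ) (k : Fin d → ℤ) : cLay r n k ≤ wBern d r k :=
  le_hasSum (hasSum_cLay r k) n fun _ _ => cLay_nonneg _ _ _

/-- The set of frequencies of the `n`-th layer. -/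
abbrev layerBox (d n : ℕ) : Finset (Fin d → ℤ) :=
  Fintype.piFinset fun _ => symIcc (2 ^ (n + 1))

lemma two_pow_le_of_notMem_symIcc {n : ℕ} {k : ℤ} (h : k ∉ symIcc (2 ^ (n + 1))) :
    (2 : ℝ) ^ (n + 1) ≤ |(k : ℝ)| := by
  have := notMem_symIcc h
  push_cast at this
  linarith

lemma cLay_eq_zero {n : ℕ} {k : Fin d → ℤ} (h : k ∉ layerBox d n) : cLay r n k = 0 := by
  simp only [layerBox, Fintype.mem_piFinset, not_forall] at h
  obtain ⟨j, hj⟩ := h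
  refine Finset.sum_eq_zero fun s hs => Finset.prod_eq_zero (Finset.mem_univ j) ?_
  refine bDyad_eq_zero_of_ge (le_trans ?_ (two_pow_le_of_notMem_symIcc hj))
  exact pow_le_pow_right₀ one_le_two (by have := le_of_mem_layerIdx hs j; omega)

lemma prod_two_rpow (a : ℝ) {n : ℕ} {s : Fin d → ℕ} (hs : s ∈ layerIdx d n) :
    ∏ j, (2 : ℝ) ^ (a * (s j : ℝ)) = 2 ^ (a * (n : ℝ)) := by
  rw [← rpow_sum_of_pos zero_lt_two, ← Finset.mul_sum, ← Nat.cast_sum, mem_layerIdx.1 hs]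

lemma sum_prod_qBern_mul_bDyad_le (hr : 0 ≤ r) (hr1 : r ≤ 1) (F : Finset ℤ) {n : ℕ}
    {s : Fin d → ℕ} (hs : s ∈ layerIdx d n) :
    ∏ j, ∑ k ∈ F, qBern r k * bDyad r (s j) k ≤ 20 ^ d * 2 ^ ((1 - 2 * r) * (n : ℝ)) := by
  calc _ ≤ ∏ j, (20 * (2 : ℝ) ^ ((1 - 2 * r) * (s j : ℝ))) := by
        refine Finset.prod_le_prod (fun j _ => ?_) fun j _ => ?_
        · exact Finset.sum_nonneg fun k _ => mul_nonneg (qBern_pos r k).le (bDyad_nonneg _ _ _)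
        · exact sum_qBern_mul_bDyad_le hr hr1 (s j) F
    _ = _ := by
        rw [Finset.prod_mul_distrib, Finset.prod_const, Finset.card_univ, Fintype.card_fin,
          prod_two_rpow _ hs]

lemma sum_cLay_sq_le {D : ℕ} (hr : 0 ≤ r) (hr1 : r ≤ 1) (n : ℕ) :
    ∑ k ∈ layerBox (D + 1) n, cLay r n k ^ 2 ≤
      20 ^ (D + 1) * ((n : ℝ) + 1) ^ D * 2 ^ ((1 - 2 * r) * (n : ℝ)) := by
  calc ∑ k ∈ layerBox (D + 1) n, cLay r n k ^ 2
      ≤ ∑ k ∈ layerBox (D + 1) n, wBern (D + 1) r k * cLay r n k := by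
        refine Finset.sum_le_sum fun k _ => ?_
        rw [sq]
        exact mul_le_mul_of_nonneg_right (cLay_le_wBern r n k) (cLay_nonneg _ _ _)
    _ = ∑ s ∈ layerIdx (D + 1) n, ∏ j, ∑ k ∈ symIcc (2 ^ (n + 1)),
          qBern r k * bDyad r (s j) k := by
        simp_rw [cLay, Finset.mul_sum]
        rw [Finset.sum_comm]
        refine Finset.sum_congr rfl fun s _ => ?_
        rw [Finset.prod_univ_sum]
        refine Finset.sum_congr rfl fun k _ => ?_
        rw [wBern, ← Finset.prod_mul_distrib]
        rfl
    _ ≤ ∑ s ∈ layerIdx (D + 1) n, 20 ^ (D + 1) * 2 ^ ((1 - 2 * r) * (n : ℝ)) := by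
        refine Finset.sum_le_sum fun s hs => ?_
        exact sum_prod_qBern_mul_bDyad_le hr hr1 _ hs
    _ ≤ 20 ^ (D + 1) * ((n : ℝ) + 1) ^ D * 2 ^ ((1 - 2 * r) * (n : ℝ)) := by
        rw [Finset.sum_const, nsmul_eq_mul]
        have : ((layerIdx (D + 1) n).card : ℝ) ≤ ((n : ℝ) + 1) ^ D := by
          exact_mod_cast card_layerIdx_le D n
        calc _ ≤ ((n : ℝ) + 1) ^ D * (20 ^ (D + 1) * 2 ^ ((1 - 2 * r) * (n : ℝ))) := by gcongr
          _ = _ := by ring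

/-- The `n`-th layer of `F_{r,0} ∗ φ`. -/
def layerOp (r : ℝ) (n : ℕ) (φ : Torus d → ℂ) : C(Torus d, ℂ) :=
  ∑ k ∈ layerBox d n, ((cLay r n k : ℂ) * fCoeff φ k) • trigChar k

lemma layerOp_apply (r : ℝ) (n : ℕ) (φ : Torus d → ℂ) (x : Torus d) :
    layerOp r n φ x = ∑ k ∈ layerBox d n, (cLay r n k : ℂ) * fCoeff φ k * trigChar k x := by
  simp [layerOp, ContinuousMap.sum_apply]

lemma layerOp_add {φ ψ : Torus d → ℂ} (hφ : Integrable φ) (hψ : Integrable ψ) (n : ℕ) :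
    layerOp r n (fun x => φ x + ψ x) = layerOp r n φ + layerOp r n ψ := by
  simp only [layerOp, fCoeff_add hφ hψ, mul_add, add_smul, Finset.sum_add_distrib]

lemma fCoeff_layerOp (φ : Torus d → ℂ) (n : ℕ) (k : Fin d → ℤ) :
    fCoeff (layerOp r n φ) k = (cLay r n k : ℂ) * fCoeff φ k := by
  rw [← fCoeffCLM_apply, layerOp, map_sum]
  simp_rw [map_smul, fCoeffCLM_apply, fCoeff_trigChar, smul_eq_mul, mul_ite, mul_one, mul_zero]
  rw [Finset.sum_ite_eq]
  split_ifs with h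
  · rfl
  · rw [cLay_eq_zero h]; simp

lemma sum_prod_bDyad_mul_trigChar {n : ℕ} {s : Fin d → ℕ} (hs : s ∈ layerIdx d n)
    (x y : Torus d) :
    ∑ k ∈ layerBox d n, ((∏ j, bDyad r (s j) (k j) : ℝ) : ℂ) *
      (trigChar k x * conj (trigChar k y)) = ∏ j, bKer r (s j) (x j - y j) := by
  have h : ∀ j, bKer r (s j) (x j - y j) = ∑ k ∈ symIcc (2 ^ (n + 1)),
      (bDyad r (s j) k : ℂ) * fourier k (x j - y j) := by
    intro j
    refine Finset.sum_subset (Finset.Icc_subset_Icc ?_ ?_) ?_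
    · have := pow_le_pow_right₀ (one_le_two (α := ℤ)) (Nat.succ_le_succ (le_of_mem_layerIdx hs j))
      push_cast
      simpa using this
    · have := pow_le_pow_right₀ (one_le_two (α := ℤ)) (Nat.succ_le_succ (le_of_mem_layerIdx hs j))
      push_cast
      simpa using this
    · intro k _ hk
      rw [bDyad_eq_zero_of_ge (two_pow_le_of_notMem_symIcc hk)]
      simp
  simp_rw [h]
  rw [Finset.prod_univ_sum]
  refine Finset.sum_congr rfl fun k _ => ?_
  rw [Finset.prod_mul_distrib, Complex.ofReal_prod, trigChar_apply, trigChar_apply, map_prod,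
    ← Finset.prod_mul_distrib]
  congr 1
  refine Finset.prod_congr rfl fun j _ => ?_
  rw [← fourier_neg, fourier_apply, fourier_apply, fourier_apply, ← Circle.coe_mul,
    ← AddCircle.toCircle_add, smul_sub, neg_smul, sub_eq_add_neg]

lemma integral_norm_prod_bKer_le (hr : 0 ≤ r) (hr1 : r ≤ 1) {n : ℕ} {s : Fin d → ℕ}
    (hs : s ∈ layerIdx d n) (x : Torus d) :
    ∫ y : Torus d, ‖∏ j, bKer r (s j) (x j - y j)‖ ≤ 5000 ^ d * 2 ^ (-r * (n : ℝ)) := by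
  simp_rw [norm_prod]
  rw [integral_fintype_prod_volume_eq_prod
    (fun j (t : AddCircle (2 * π)) => ‖bKer r (s j) (x j - t)‖)]
  rw [← prod_two_rpow _ hs]
  calc _ ≤ ∏ j, 5000 * (2 : ℝ) ^ (-r * (s j : ℝ)) := by
        refine Finset.prod_le_prod (fun j _ => integral_nonneg fun _ => norm_nonneg _) fun j _ => ?_
        rw [integral_sub_left_eq_self (fun t => ‖bKer r (s j) t‖) volume (x j)]
        exact integral_norm_bKer_le hr hr1 _
    _ = _ := by rw [Finset.prod_mul_distrib]; simp

lemma layerOp_apply_eq_sum_integral {φ : Torus d → ℂ} (hφ : Integrable φ) (n : ℕ) (x : Torus d) :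
    layerOp r n φ x = (((2 * π) ^ d)⁻¹ : ℝ) * ∑ s ∈ layerIdx d n,
      ∫ y : Torus d, (∏ j, bKer r (s j) (x j - y j)) * φ y := by
  rw [layerOp_apply]
  simp_rw [cLay, Complex.ofReal_sum, Finset.sum_mul]
  rw [Finset.sum_comm, Finset.mul_sum]
  refine Finset.sum_congr rfl fun s hs => ?_
  simp_rw [← sum_prod_bDyad_mul_trigChar hs, Finset.sum_mul]
  rw [integral_finsetSum _ fun k _ => ?_, Finset.mul_sum]
  · refine Finset.sum_congr rfl fun k _ => ?_
    simp_rw [mul_assoc]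
    rw [integral_const_mul, integral_const_mul, fCoeff, Complex.real_smul]
    ring
  · simp_rw [mul_assoc]
    exact ((integrable_conj_trigChar_mul k hφ).const_mul _).const_mul _

/-- Bounds for the layers of bounded functions. -/
lemma norm_layerOp_le_of_bounded {D : ℕ} (hr : 0 ≤ r) (hr1 : r ≤ 1)
    {φ : Torus (D + 1) → ℂ} (hφ : Integrable φ) {L : ℝ} (hL : 0 ≤ L) (hb : ∀ x, ‖φ x‖ ≤ L)
    (n : ℕ) : ‖layerOp r n φ‖ ≤ 5000 ^ (D + 1) * ((n : ℝ) + 1) ^ D * 2 ^ (-r * (n : ℝ)) * L := by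
  rw [ContinuousMap.norm_le _ (by positivity)]
  intro x
  rw [layerOp_apply_eq_sum_integral hφ, norm_mul, Complex.norm_real,
    norm_of_nonneg (by positivity)]
  have h1 : ((2 * π) ^ (D + 1))⁻¹ ≤ 1 :=
    inv_le_one_of_one_le₀ (one_le_pow₀ (by linarith [pi_gt_three]))
  refine (mul_le_of_le_one_left (norm_nonneg _) h1).trans ?_
  refine (norm_sum_le _ _).trans ?_
  have hc : ∀ s : Fin (D + 1) → ℕ, Continuous fun y : Torus (D + 1) =>
      ∏ j, bKer r (s j) (x j - y j) := fun s =>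
    continuous_finsetProd _ fun j _ =>
      (continuous_bKer r (s j)).comp (continuous_const.sub (continuous_apply j))
  calc _ ≤ ∑ s ∈ layerIdx (D + 1) n, 5000 ^ (D + 1) * (2 : ℝ) ^ (-r * (n : ℝ)) * L := by
        refine Finset.sum_le_sum fun s hs => ?_
        calc _ ≤ ∫ y : Torus (D + 1), ‖∏ j, bKer r (s j) (x j - y j)‖ * L := by
              refine norm_integral_le_of_norm_le
                ((integrable_of_continuous_of_compact (hc s)).norm.mul_const L)
                (Filter.Eventually.of_forall fun y => ?_)
              rw [norm_mul]
              gcongr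
              exact hb y
          _ ≤ _ := by
              rw [integral_mul_const]
              gcongr
              exact integral_norm_prod_bKer_le hr hr1 hs x
    _ ≤ _ := by
        rw [Finset.sum_const, nsmul_eq_mul]
        have : ((layerIdx (D + 1) n).card : ℝ) ≤ ((n : ℝ) + 1) ^ D := by
          exact_mod_cast card_layerIdx_le D n
        calc _ ≤ ((n : ℝ) + 1) ^ D * (5000 ^ (D + 1) * 2 ^ (-r * (n : ℝ)) * L) := by gcongr
          _ = _ := by ring

/-- Bounds for the layers of square integrable functions. -/
lemma norm_layerOp_le_of_sq {D : ℕ} (hr : 0 ≤ r) (hr1 : r ≤ 1)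
    {φ : Torus (D + 1) → ℂ} {L : ℝ} (hL : 0 ≤ L) {n : ℕ}
    (hb : ∑ k ∈ layerBox (D + 1) n, ‖fCoeff φ k‖ ^ 2 ≤ L ^ 2) :
    ‖layerOp r n φ‖ ≤ √(20 ^ (D + 1) * ((n : ℝ) + 1) ^ D * 2 ^ ((1 - 2 * r) * (n : ℝ))) * L := by
  rw [ContinuousMap.norm_le _ (by positivity)]
  intro x
  rw [layerOp_apply]
  calc _ ≤ ∑ k ∈ layerBox (D + 1) n, cLay r n k * ‖fCoeff φ k‖ := by
        refine (norm_sum_le _ _).trans (Finset.sum_le_sum fun k _ => ?_)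
        rw [norm_mul, norm_trigChar_apply, norm_mul, Complex.norm_real,
          norm_of_nonneg (cLay_nonneg _ _ _), mul_one]
    _ ≤ √(∑ k ∈ layerBox (D + 1) n, cLay r n k ^ 2) *
          √(∑ k ∈ layerBox (D + 1) n, ‖fCoeff φ k‖ ^ 2) :=
        sum_mul_le_sqrt_mul_sqrt _ _ _
    _ ≤ _ := by
        gcongr
        · exact sum_cLay_sq_le hr hr1 n
        · exact (sqrt_le_left hL).2 hb

end Layers

section Nets

lemma norm_fourier_sub_le (n : ℤ) (s t : ℝ) :
    ‖fourier n (s : AddCircle (2 * π)) - fourier n (t : AddCircle (2 * π))‖ ≤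
      |(n : ℝ)| * |s - t| := by
  have h : ∀ u : ℝ, fourier n (u : AddCircle (2 * π)) = Complex.exp (Complex.I * (n * u : ℝ)) := by
    intro u
    rw [fourier_coe_apply]
    congr 1
    have : (π : ℂ) ≠ 0 := by simp [pi_ne_zero]
    push_cast
    field_simp
  have h2 : Complex.exp (Complex.I * (n * s : ℝ)) - Complex.exp (Complex.I * (n * t : ℝ)) =
      Complex.exp (Complex.I * (n * t : ℝ)) * (Complex.exp (Complex.I * (n * (s - t) : ℝ)) - 1) := by
    rw [mul_sub, mul_one, ← Complex.exp_add]
    congr 2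
    push_cast
    ring
  rw [h, h, h2, norm_mul, mul_comm Complex.I, Complex.norm_exp_ofReal_mul_I, one_mul]
  refine norm_exp_I_mul_ofReal_sub_one_le.trans ?_
  rw [norm_eq_abs, abs_mul]

lemma norm_prod_sub_prod_le_sum {ι : Type*} (F : Finset ι) (a b : ι → ℂ) (ha : ∀ i, ‖a i‖ ≤ 1)
    (hb : ∀ i, ‖b i‖ ≤ 1) :
    ‖∏ i ∈ F, a i - ∏ i ∈ F, b i‖ ≤ ∑ i ∈ F, ‖a i - b i‖ := by
  induction F using Finset.induction_on with
  | empty => simp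
  | insert i F hi ih =>
    rw [Finset.prod_insert hi, Finset.prod_insert hi, Finset.sum_insert hi]
    have h : a i * ∏ i ∈ F, a i - b i * ∏ i ∈ F, b i =
        (a i - b i) * ∏ i ∈ F, a i + b i * (∏ i ∈ F, a i - ∏ i ∈ F, b i) := by ring
    rw [h]
    refine (norm_add_le _ _).trans (add_le_add ?_ ?_)
    · rw [norm_mul]
      refine mul_le_of_le_one_right (norm_nonneg _) ?_
      rw [norm_prod]
      exact Finset.prod_le_one (fun _ _ => norm_nonneg _) fun j _ => ha j
    · rw [norm_mul]
      exact (mul_le_of_le_one_left (norm_nonneg _) (hb i)).trans ih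

lemma exists_grid_point {Q : ℕ} (hQ : 0 < Q) (x : AddCircle (2 * π)) :
    ∃ (i : Fin Q) (t : ℝ), x = (t : AddCircle (2 * π)) ∧ |t - 2 * π * i / Q| ≤ 2 * π / Q := by
  obtain ⟨t, ht, rfl⟩ : ∃ t ∈ Set.Ico (0 : ℝ) (2 * π), (t : AddCircle (2 * π)) = x := by
    have := AddCircle.coe_image_Ico_eq (2 * π) 0
    have hx : x ∈ ((↑) : ℝ → AddCircle (2 * π)) '' Set.Ico 0 (0 + 2 * π) := by
      rw [this]; trivial
    simpa using hx
  have hQ' : (0 : ℝ) < Q := by exact_mod_cast hQ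
  have h0 : 0 ≤ t / (2 * π) * Q := mul_nonneg (div_nonneg ht.1 two_pi_pos.le) hQ'.le
  have hlt : ⌊t / (2 * π) * Q⌋₊ < Q := by
    rw [Nat.floor_lt h0]
    exact mul_lt_of_lt_one_left hQ' ((div_lt_one two_pi_pos).2 ht.2)
  refine ⟨⟨_, hlt⟩, t, rfl, ?_⟩
  have h1 := Nat.floor_le h0
  have h2 := Nat.lt_floor_add_one (t / (2 * π) * Q)
  have h3 : t - 2 * π * (⌊t / (2 * π) * Q⌋₊ : ℕ) / Q =
      2 * π / Q * (t / (2 * π) * Q - (⌊t / (2 * π) * Q⌋₊ : ℕ)) := by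
    field_simp
  rw [h3, abs_mul, abs_of_pos (by positivity : 0 < 2 * π / (Q : ℝ))]
  refine mul_le_of_le_one_right (by positivity) ?_
  rw [abs_le]
  constructor <;> linarith

/-- The uniform grid with `Q ^ d` points. -/
def gridPt {d : ℕ} (Q : ℕ) (i : Fin d → Fin Q) : Torus d :=
  fun j => ((2 * π * i j / Q : ℝ) : AddCircle (2 * π))

lemma exists_grid_trigChar {d : ℕ} {Q : ℕ} (hQ : 0 < Q) (x : Torus d) :
    ∃ i : Fin d → Fin Q, ∀ (M : ℝ) (k : Fin d → ℤ), (∀ j, |(k j : ℝ)| ≤ M) →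
      ‖trigChar k x - trigChar k (gridPt Q i)‖ ≤ d * M * (2 * π / Q) := by
  choose i t hx ht using fun j => exists_grid_point hQ (x j)
  refine ⟨i, fun M k hk => ?_⟩
  rw [trigChar_apply, trigChar_apply]
  refine (norm_prod_sub_prod_le_sum _ _ _ (fun j => (Circle.norm_coe _).le)
    fun j => (Circle.norm_coe _).le).trans ?_
  calc _ ≤ ∑ _j : Fin d, M * (2 * π / Q) := by
        refine Finset.sum_le_sum fun j _ => ?_
        rw [hx j]
        have hM : 0 ≤ M := (abs_nonneg _).trans (hk j)
        exact (norm_fourier_sub_le _ _ _).trans (mul_le_mul (hk j) (ht j) (abs_nonneg _) hM)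
    _ = d * M * (2 * π / Q) := by simp [mul_assoc]

/-- The trigonometric sum with weights `w`, frequencies `κ` and coefficients `y`. -/
def trigSum {d : ℕ} {ι : Type*} [Fintype ι] (w : ι → ℝ) (κ : ι → Fin d → ℤ) (y : ι → ℂ) :
    C(Torus d, ℂ) := ∑ i, ((w i : ℂ) * y i) • trigChar (κ i)

lemma trigSum_apply {d : ℕ} {ι : Type*} [Fintype ι] (w : ι → ℝ) (κ : ι → Fin d → ℤ) (y : ι → ℂ)
    (x : Torus d) : trigSum w κ y x = ∑ i, (w i : ℂ) * y i * trigChar (κ i) x := by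
  simp [trigSum, ContinuousMap.sum_apply]

lemma norm_trigSum_sub_le {d : ℕ} {ι : Type*} [Fintype ι] {w : ι → ℝ} {κ : ι → Fin d → ℤ}
    {y : ι → ℂ} {A R η : ℝ} (hA : 0 ≤ A) (hR : 0 ≤ R)
    (hw : ∑ i, w i ^ 2 ≤ A ^ 2) (hy : ∑ i, ‖y i‖ ^ 2 ≤ R ^ 2) {x x' : Torus d} (hη : 0 ≤ η)
    (hx : ∀ i, ‖trigChar (κ i) x - trigChar (κ i) x'‖ ≤ η) :
    ‖trigSum w κ y x - trigSum w κ y x'‖ ≤ A * R * η := by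
  rw [trigSum_apply, trigSum_apply, ← Finset.sum_sub_distrib]
  calc _ ≤ ∑ i, |w i| * ‖y i‖ * η := by
        refine (norm_sum_le _ _).trans (Finset.sum_le_sum fun i _ => ?_)
        rw [← mul_sub, norm_mul, norm_mul, Complex.norm_real, norm_eq_abs]
        gcongr
        exact hx i
    _ = (∑ i, |w i| * ‖y i‖) * η := by rw [Finset.sum_mul]
    _ ≤ A * R * η := by
        gcongr
        refine (sum_mul_le_sqrt_mul_sqrt _ _ _).trans ?_
        simp_rw [sq_abs]
        gcongr
        · exact (sqrt_le_left hA).2 hw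
        · exact (sqrt_le_left hR).2 hy

/-- Real coordinates of a complex vector. -/
def realVec {ι : Type*} [Fintype ι] (y : ι → ℂ) : EuclideanSpace ℝ (ι ⊕ ι) :=
  WithLp.toLp 2 (Sum.elim (fun i => (y i).re) fun i => (y i).im)

/-- Complex vector from real coordinates. -/
def complexVec {ι : Type*} [Fintype ι] (v : EuclideanSpace ℝ (ι ⊕ ι)) (i : ι) : ℂ :=
  ⟨v (Sum.inl i), v (Sum.inr i)⟩

lemma norm_sq_realVec {ι : Type*} [Fintype ι] (y : ι → ℂ) :
    ‖realVec y‖ ^ 2 = ∑ i, ‖y i‖ ^ 2 := by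
  rw [EuclideanSpace.norm_sq_eq, Fintype.sum_sum_type, ← Finset.sum_add_distrib]
  refine Finset.sum_congr rfl fun i _ => ?_
  rw [← Complex.normSq_eq_norm_sq, Complex.normSq_apply]
  simp [realVec, sq]

lemma realVec_complexVec {ι : Type*} [Fintype ι] (v : EuclideanSpace ℝ (ι ⊕ ι)) :
    realVec (complexVec v) = v := by
  ext i
  cases i <;> rfl

lemma inner_realVec {ι : Type*} [Fintype ι] (a y z : ι → ℂ) :
    inner ℝ (realVec a) (realVec y - realVec z) = (∑ i, conj (a i) * (y i - z i)).re := by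
  rw [PiLp.inner_apply, Fintype.sum_sum_type, ← Finset.sum_add_distrib, Complex.re_sum]
  refine Finset.sum_congr rfl fun i _ => ?_
  simp [realVec]
  ring

/-- Finite nets in the uniform norm for balls of trigonometric sums. -/
lemma exists_net_trigSum {d : ℕ} {ι : Type*} [Fintype ι] {w : ι → ℝ} {κ : ι → Fin d → ℤ}
    {A R M ε : ℝ} {Q : ℕ} (hA : 0 < A) (hR : 0 ≤ R) (hM : 0 ≤ M) (hε : 0 < ε) (hQ : 0 < Q)
    (hw : ∑ i, w i ^ 2 ≤ A ^ 2) (hκ : ∀ i j, |(κ i j : ℝ)| ≤ M) :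
    ∃ Z : Finset C(Torus d, ℂ),
      (Z.card : ℝ) ≤ 2 * exp (4 * (A * R / ε) ^ 2 * log (4 * (Q ^ d * 2))) ∧
      ∀ y : ι → ℂ, ∑ i, ‖y i‖ ^ 2 ≤ R ^ 2 → ∃ z ∈ Z,
        ‖trigSum w κ y - z‖ ≤ 2 * ε + 2 * (A * R * (d * M * (2 * π / Q))) := by
  have : NeZero Q := ⟨hQ.ne'⟩
  set a : (Fin d → Fin Q) × Bool → EuclideanSpace ℝ (ι ⊕ ι) := fun q =>
    realVec fun i => (w i : ℂ) * conj (trigChar (κ i) (gridPt Q q.1)) *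
      (if q.2 then 1 else Complex.I) with ha
  have hna : ∀ q, ‖a q‖ ≤ A := by
    intro q
    refine abs_le_of_sq_le_sq' ?_ hA.le |>.2
    rw [ha, norm_sq_realVec]
    refine le_trans (Finset.sum_le_sum fun i _ => ?_) hw
    rw [norm_mul, norm_mul, RCLike.norm_conj, norm_trigChar_apply, Complex.norm_real, norm_eq_abs]
    split_ifs <;> simp
  obtain ⟨F, hFR, hFc, hF⟩ := exists_net a (A := A) (R := R) hA hε hna
  refine ⟨F.image fun v => trigSum w κ (complexVec v), ?_, ?_⟩
  · refine le_trans (by exact_mod_cast Finset.card_image_le) (hFc.trans_eq ?_)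
    simp
  intro y hy
  have hyR : ‖realVec y‖ ≤ R :=
    (abs_le_of_sq_le_sq' (by rw [norm_sq_realVec]; exact hy) hR).2
  obtain ⟨v, hv, hyv⟩ := hF _ hyR
  refine ⟨_, Finset.mem_image_of_mem _ hv, ?_⟩
  have hz : ∑ i, ‖complexVec v i‖ ^ 2 ≤ R ^ 2 := by
    rw [← norm_sq_realVec, realVec_complexVec]
    exact pow_le_pow_left₀ (norm_nonneg _) (hFR v hv) 2
  have hgrid : ∀ i : Fin d → Fin Q,
      ‖trigSum w κ y (gridPt Q i) - trigSum w κ (complexVec v) (gridPt Q i)‖ ≤ 2 * ε := by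
    intro i
    have h : ∀ b : Bool, inner ℝ (a (i, b)) (realVec y - v) =
        ((trigSum w κ y (gridPt Q i) - trigSum w κ (complexVec v) (gridPt Q i)) *
          (if b then 1 else -Complex.I)).re := by
      intro b
      conv_lhs => rw [← realVec_complexVec v]
      rw [ha, inner_realVec, trigSum_apply, trigSum_apply, ← Finset.sum_sub_distrib,
        Finset.sum_mul]
      congr 1
      refine Finset.sum_congr rfl fun l _ => ?_
      rw [map_mul, map_mul, Complex.conj_conj, Complex.conj_ofReal]
      split_ifs
      · rw [map_one]; ring
      · rw [Complex.conj_I]; ring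
    have h1 := hyv (i, true)
    have h2 := hyv (i, false)
    rw [h] at h1 h2
    simp only [if_true, mul_one, Bool.false_eq_true, if_false, Complex.mul_re, Complex.neg_re,
      Complex.I_re, Complex.I_im, mul_zero, mul_neg, zero_sub,
      neg_neg] at h1 h2
    refine (Complex.norm_le_abs_re_add_abs_im _).trans ?_
    linarith
  rw [ContinuousMap.norm_le _ (by positivity)]
  intro x
  obtain ⟨i, hi⟩ := exists_grid_trigChar hQ x
  have hη : 0 ≤ d * M * (2 * π / Q) := by positivity
  have e1 := norm_trigSum_sub_le hA.le hR hw hy hη fun l => hi M (κ l) (hκ l)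
  have e2 := norm_trigSum_sub_le hA.le hR hw hz hη fun l => hi M (κ l) (hκ l)
  rw [ContinuousMap.sub_apply]
  have h3 := norm_sub_le_norm_sub_add_norm_sub (trigSum w κ y x) (trigSum w κ y (gridPt Q i))
    (trigSum w κ (complexVec v) x)
  have h4 := norm_sub_le_norm_sub_add_norm_sub (trigSum w κ y (gridPt Q i))
    (trigSum w κ (complexVec v) (gridPt Q i)) (trigSum w κ (complexVec v) x)
  rw [norm_sub_rev (trigSum w κ (complexVec v) (gridPt Q i)) (trigSum w κ (complexVec v) x)] at h4
  linarith [hgrid i]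

end Nets

section Truncation

variable {d : ℕ} {p : ℝ}

lemma integral_norm_rpow_le (hp : 0 < p) {φ : Lp ℂ (ENNReal.ofReal p) (volume : Measure (Torus d))}
    {B : ℝ} (hφ : ‖φ‖ ≤ B) : ∫ x, ‖φ x‖ ^ p ≤ B ^ p := by
  have h := (Lp.memLp φ).eLpNorm_eq_integral_rpow_norm (by simpa using hp) ENNReal.ofReal_ne_top
  rw [ENNReal.toReal_ofReal hp.le] at h
  have hI : 0 ≤ ∫ x, ‖φ x‖ ^ p := integral_nonneg fun x => by positivity
  have h2 : (∫ x, ‖φ x‖ ^ p) ^ p⁻¹ ≤ B := by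
    rw [Lp.norm_def, h, ENNReal.toReal_ofReal (by positivity)] at hφ
    exact hφ
  have h3 := rpow_le_rpow (by positivity) h2 hp.le
  rwa [← rpow_mul hI, inv_mul_cancel₀ hp.ne', rpow_one] at h3

/-- Splitting a function into a bounded part and a square integrable part. -/
lemma exists_truncation (hp : 2 < p) {φ : Lp ℂ (ENNReal.ofReal p) (volume : Measure (Torus d))}
    (hφ : ‖φ‖ ≤ 2) {L : ℝ} (hL : 0 ≤ L) :
    ∃ g h : Torus d → ℂ, Integrable g ∧ Integrable h ∧ (∀ x, φ x = g x + h x) ∧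
      (∀ x, ‖g x‖ ≤ L) ∧ ∀ F : Finset (Fin d → ℤ), ∑ k ∈ F, ‖fCoeff h k‖ ^ 2 ≤
        (1 + 2 ^ p) * if L = 0 then 1 else L ^ (2 - p) := by
  have hp0 : 0 < p := by linarith
  have hmeas : StronglyMeasurable (φ : Torus d → ℂ) := Lp.stronglyMeasurable φ
  have hS : MeasurableSet {x | ‖φ x‖ ≤ L} := measurableSet_le hmeas.norm.measurable measurable_const
  have hφ2 : MemLp (φ : Torus d → ℂ) 2 := (Lp.memLp φ).mono_exponent (by
    rw [← ENNReal.ofReal_ofNat 2]; exact ENNReal.ofReal_le_ofReal hp.le)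
  have hint : Integrable fun x => ‖φ x‖ ^ p := by
    have := (Lp.memLp φ).integrable_norm_rpow (by simpa using hp0) ENNReal.ofReal_ne_top
    rwa [ENNReal.toReal_ofReal hp0.le] at this
  have hg : MemLp ({x | ‖φ x‖ ≤ L}.indicator (φ : Torus d → ℂ)) 2 := hφ2.indicator hS
  have hh : MemLp ({x | ‖φ x‖ ≤ L}ᶜ.indicator (φ : Torus d → ℂ)) 2 := hφ2.indicator hS.compl
  refine ⟨_, _, hg.integrable one_le_two, hh.integrable one_le_two, ?_, ?_, ?_⟩
  · intro x
    exact (congrFun (Set.indicator_self_add_compl _ (φ : Torus d → ℂ)) x).symm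
  · intro x
    rw [Set.indicator_apply]
    split_ifs with h
    · exact h
    · simpa using hL
  have hhi := (memLp_two_iff_integrable_sq_norm hh.1).1 hh
  intro F
  refine (sum_norm_fCoeff_sq_le hh F).trans ?_
  have hc : (1 : ℝ) ≤ (2 * π) ^ d := one_le_pow₀ (by linarith [pi_gt_three])
  have hI0 : 0 ≤ ∫ x, ‖φ x‖ ^ p := integral_nonneg fun x => by positivity
  have hI := integral_norm_rpow_le hp0 hφ
  rw [inv_mul_le_iff₀ (by positivity)]
  have h2p : (0 : ℝ) < 2 ^ p := by positivity
  split_ifs with h0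
  · calc _ ≤ ∫ x, (1 + ‖φ x‖ ^ p) := by
          refine integral_mono hhi ((integrable_const 1).add hint) fun x => ?_
          dsimp only
          rw [Set.indicator_apply]
          have hx := rpow_nonneg (norm_nonneg (φ x)) p
          split_ifs
          · rcases le_total ‖φ x‖ 1 with h1 | h1
            · have : ‖φ x‖ ^ 2 ≤ 1 := pow_le_one₀ (norm_nonneg _) h1
              linarith
            · have := rpow_le_rpow_of_exponent_le h1 hp.le
              rw [rpow_two] at this
              linarith
          · simp; linarith
      _ = (2 * π) ^ d + ∫ x, ‖φ x‖ ^ p := by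
          rw [integral_add (integrable_const 1) hint, integral_const, volume_real_torus]
          simp
      _ ≤ (2 * π) ^ d * ((1 + 2 ^ p) * 1) := by nlinarith
  · have hL0 : 0 < L := lt_of_le_of_ne hL (Ne.symm h0)
    have hL2 : 0 < L ^ (2 - p) := rpow_pos_of_pos hL0 _
    calc _ ≤ ∫ x, L ^ (2 - p) * ‖φ x‖ ^ p := by
          refine integral_mono hhi (hint.const_mul _) fun x => ?_
          dsimp only
          rw [Set.indicator_apply]
          split_ifs with h
          · have h1 : L < ‖φ x‖ := by simpa using h
            have h2 : ‖φ x‖ ^ 2 = ‖φ x‖ ^ (2 - p) * ‖φ x‖ ^ p := by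
              rw [← rpow_add (hL0.trans h1), sub_add_cancel, rpow_two]
            rw [h2]
            exact mul_le_mul_of_nonneg_right (rpow_le_rpow_of_nonpos hL0 h1.le (by linarith))
              (by positivity)
          · simp; positivity
      _ = L ^ (2 - p) * ∫ x, ‖φ x‖ ^ p := integral_const_mul _ _
      _ ≤ L ^ (2 - p) * (2 ^ p) := by gcongr
      _ ≤ 1 * ((1 + 2 ^ p) * L ^ (2 - p)) := by nlinarith
      _ ≤ (2 * π) ^ d * ((1 + 2 ^ p) * L ^ (2 - p)) := by gcongr

end Truncation

section DecayingSums

/-- The summands `(n + 1)^D 2^{-δ |n - N|}`. -/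
def decay (δ : ℝ) (D N n : ℕ) : ℝ := ((n : ℝ) + 1) ^ D * 2 ^ (-δ * |(n : ℝ) - N|)

lemma decay_nonneg (δ : ℝ) (D N n : ℕ) : 0 ≤ decay δ D N n := by unfold decay; positivity

lemma summable_pow_mul_two_rpow {δ : ℝ} (hδ : 0 < δ) (D : ℕ) :
    Summable fun n : ℕ => ((n : ℝ) + 1) ^ D * (2 : ℝ) ^ (-δ * n) := by
  have hx : ‖(2 : ℝ) ^ (-δ)‖ < 1 := by
    rw [norm_of_nonneg (by positivity)]
    exact rpow_lt_one_of_one_lt_of_neg one_lt_two (by linarith)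
  have hpow : ∀ n : ℕ, (2 : ℝ) ^ (-δ * n) = ((2 : ℝ) ^ (-δ)) ^ n := fun n => by
    rw [rpow_mul zero_le_two, rpow_natCast]
  have hq0 : (2 : ℝ) ^ (-δ) ≠ 0 := (rpow_pos_of_pos zero_lt_two _).ne'
  simp_rw [hpow]
  generalize (2 : ℝ) ^ (-δ) = q at hx hq0
  have h : Summable fun n : ℕ => (((n + 1 : ℕ) : ℝ)) ^ D * q ^ (n + 1) :=
    (summable_nat_add_iff (f := fun n : ℕ => (n : ℝ) ^ D * q ^ n) 1).2
      (summable_pow_mul_geometric_of_norm_lt_one D hx)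
  refine (h.mul_left q⁻¹).congr fun n => ?_
  rw [pow_succ, Nat.cast_succ]
  field_simp

lemma exists_decay_bound {δ : ℝ} (hδ : 0 < δ) (D : ℕ) :
    ∃ C : ℝ, 0 < C ∧ ∀ N : ℕ, Summable (decay δ D N) ∧
      ∑' n, decay δ D N n ≤ C * ((N : ℝ) + 1) ^ D := by
  set u : ℕ → ℝ := fun n => ((n : ℝ) + 1) ^ D * (2 : ℝ) ^ (-δ * n) with hu
  have hus : Summable u := summable_pow_mul_two_rpow hδ D
  have hu0 : ∀ n, 0 < u n := fun n => by simp only [hu]; positivity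
  have hT : 0 < ∑' n, u n := hus.tsum_pos (fun n => (hu0 n).le) 0 (hu0 0)
  refine ⟨2 * ∑' n, u n, by positivity, fun N => ?_⟩
  have hle : ∀ n, decay δ D N n ≤ ((N : ℝ) + 1) ^ D * u (n - N + (N - n)) := by
    intro n
    have habs : |(n : ℝ) - N| = ((n - N + (N - n) : ℕ) : ℝ) := by
      rcases le_total n N with h | h
      · have h' : (n : ℝ) ≤ N := by exact_mod_cast h
        rw [abs_of_nonpos (by linarith), Nat.sub_eq_zero_of_le h, zero_add, Nat.cast_sub h]
        ring
      · have h' : (N : ℝ) ≤ n := by exact_mod_cast h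
        rw [abs_of_nonneg (by linarith), Nat.sub_eq_zero_of_le h, add_zero, Nat.cast_sub h]
    rw [decay, hu, habs, ← mul_assoc, ← mul_pow]
    gcongr
    rw [← habs]
    have h1 := le_abs_self ((n : ℝ) - N)
    have h2 := abs_nonneg ((n : ℝ) - N)
    have h3 : (0 : ℝ) ≤ N := by positivity
    nlinarith
  have hbound : ∀ F : Finset ℕ, ∑ n ∈ F, decay δ D N n ≤
      2 * (∑' n, u n) * ((N : ℝ) + 1) ^ D := by
    intro F
    have h1 : ∑ n ∈ F, u (n - N + (N - n)) ≤ 2 * ∑' n, u n := by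
      rw [← Finset.sum_filter_add_sum_filter_not F (fun n => n ≤ N), two_mul]
      have key : ∀ (G : Finset ℕ), Set.InjOn (fun n => n - N + (N - n)) G →
          ∑ n ∈ G, u (n - N + (N - n)) ≤ ∑' n, u n := by
        intro G hG
        rw [← Finset.sum_image (f := u) hG]
        exact hus.sum_le_tsum _ fun n _ => (hu0 n).le
      refine add_le_add (key _ ?_) (key _ ?_)
      · intro a ha b hb hab
        simp only [Finset.coe_filter, Set.mem_ofPred_eq] at ha hb hab
        omega
      · intro a ha b hb hab
        simp only [Finset.coe_filter, Set.mem_ofPred_eq] at ha hb hab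
        omega
    calc _ ≤ ∑ n ∈ F, ((N : ℝ) + 1) ^ D * u (n - N + (N - n)) :=
          Finset.sum_le_sum fun n _ => hle n
      _ = ((N : ℝ) + 1) ^ D * ∑ n ∈ F, u (n - N + (N - n)) := by rw [Finset.mul_sum]
      _ ≤ ((N : ℝ) + 1) ^ D * (2 * ∑' n, u n) := by gcongr
      _ = _ := by ring
  have hs : Summable (decay δ D N) :=
    summable_of_sum_le (fun n => decay_nonneg δ D N n) hbound
  exact ⟨hs, hs.tsum_le_of_sum_le hbound⟩

end DecayingSums

section Approximation

/-- The exponents of the weights balancing the layers around the level `N`. -/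
def wExp (b δ : ℝ) (N n : ℕ) : ℝ :=
  if n ≤ N then δ * ((n : ℝ) - N) else (b - δ) * ((n : ℝ) - N)

/-- The truncation levels. -/
def truncLevel (κ : ℝ) (N n : ℕ) : ℝ := if n ≤ N then 0 else 2 ^ (κ * ((n : ℝ) - N))

/-- The part of the representation which is treated by an entropy argument. -/
def mainPart (d : ℕ) (r b δ : ℝ) (N M : ℕ) (y : ℕ → (Fin d → ℤ) → ℂ) : C(Torus d, ℂ) :=
  ∑ n ∈ Finset.range M, ∑ k ∈ layerBox d n,
    (((2 : ℝ) ^ (-(wExp b δ N n / 2)) * cLay r n k : ℝ) * y n k) • trigChar k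

lemma truncLevel_nonneg (κ : ℝ) (N n : ℕ) : 0 ≤ truncLevel κ N n := by
  unfold truncLevel; split_ifs <;> positivity

lemma sum_weighted_cLay_sq_le {D : ℕ} {r b δ : ℝ} (hr : 0 ≤ r) (hr1 : r ≤ 1)
    (h1 : 2 * δ ≤ 1 - 2 * r) (h2 : 2 * δ ≤ b - (1 - 2 * r)) (N n : ℕ) :
    ∑ k ∈ layerBox (D + 1) n, ((2 : ℝ) ^ (-(wExp b δ N n / 2)) * cLay r n k) ^ 2 ≤
      20 ^ (D + 1) * 2 ^ ((1 - 2 * r) * N) * decay δ D N n := by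
  have hsq : ((2 : ℝ) ^ (-(wExp b δ N n / 2))) ^ 2 = 2 ^ (-wExp b δ N n) := by
    rw [← rpow_natCast, ← rpow_mul zero_le_two]; congr 1; push_cast; ring
  simp_rw [mul_pow, hsq, ← Finset.mul_sum]
  have hexp : -wExp b δ N n + (1 - 2 * r) * n ≤ (1 - 2 * r) * N + -δ * |(n : ℝ) - N| := by
    unfold wExp
    split_ifs with h
    · have h' : (n : ℝ) - N ≤ 0 := by simpa using h
      rw [abs_of_nonpos h']; nlinarith
    · have h' : 0 ≤ (n : ℝ) - N := by simpa using (not_le.1 h).le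
      rw [abs_of_nonneg h']; nlinarith
  calc _ ≤ (2 : ℝ) ^ (-wExp b δ N n) * (20 ^ (D + 1) * ((n : ℝ) + 1) ^ D *
          2 ^ ((1 - 2 * r) * (n : ℝ))) := by gcongr; exact sum_cLay_sq_le hr hr1 n
    _ = 20 ^ (D + 1) * ((n : ℝ) + 1) ^ D * 2 ^ (-wExp b δ N n + (1 - 2 * r) * n) := by
        rw [rpow_add two_pos]; ring
    _ ≤ 20 ^ (D + 1) * ((n : ℝ) + 1) ^ D * 2 ^ ((1 - 2 * r) * N + -δ * |(n : ℝ) - N|) := by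
        gcongr; exact one_le_two
    _ = _ := by rw [rpow_add two_pos, decay]; ring

lemma two_rpow_wExp_mul_le {p κ δ : ℝ} (N n : ℕ) :
    (2 : ℝ) ^ wExp (κ * (p - 2)) δ N n *
      (if truncLevel κ N n = 0 then 1 else truncLevel κ N n ^ (2 - p)) = decay δ 0 N n := by
  unfold wExp truncLevel decay
  by_cases h : n ≤ N
  · have h' : (n : ℝ) - N ≤ 0 := by simpa using h
    rw [if_pos h, if_pos h, if_pos rfl, abs_of_nonpos h', mul_one, pow_zero, one_mul]
    congr 1; ring
  · have h' : 0 ≤ (n : ℝ) - N := by simpa using (not_le.1 h).le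
    rw [if_neg h, if_neg h, if_neg (rpow_pos_of_pos two_pos _).ne', abs_of_nonneg h',
      pow_zero, one_mul, ← rpow_mul zero_le_two, ← rpow_add two_pos]
    congr 1; ring

lemma norm_layerOp_bounded_le {D : ℕ} {r κ : ℝ} (hr : 0 ≤ r) (hr1 : r ≤ 1)
    {g : Torus (D + 1) → ℂ} (hg : Integrable g) {N n : ℕ} (hb : ∀ x, ‖g x‖ ≤ truncLevel κ N n) :
    ‖layerOp r n g‖ ≤ 5000 ^ (D + 1) * 2 ^ (-r * N) * decay (r - κ) D N n := by
  refine (norm_layerOp_le_of_bounded hr hr1 hg (truncLevel_nonneg κ N n) hb n).trans ?_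
  unfold truncLevel decay
  split_ifs with h
  · simp only [mul_zero]; positivity
  · have h' : 0 ≤ (n : ℝ) - N := by simpa using (not_le.1 h).le
    rw [abs_of_nonneg h', mul_assoc, ← rpow_add two_pos]
    have : (2 : ℝ) ^ (-r * (n : ℝ) + κ * ((n : ℝ) - N)) =
        2 ^ (-r * N) * 2 ^ (-(r - κ) * ((n : ℝ) - N)) := by
      rw [← rpow_add two_pos]; congr 1; ring
    rw [this]
    exact le_of_eq (by ring)

lemma norm_layerOp_tail_le {D : ℕ} {p r κ δ : ℝ} (hr : 0 ≤ r) (hr1 : r ≤ 1)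
    (h2 : 2 * δ ≤ κ * (p - 2) - (1 - 2 * r)) {h : Torus (D + 1) → ℂ} {N n : ℕ} (hn : N < n)
    (hnδ : (N : ℝ) ≤ δ * ((n : ℝ) - N))
    (hb : ∀ F : Finset (Fin (D + 1) → ℤ), ∑ k ∈ F, ‖fCoeff h k‖ ^ 2 ≤ (1 + 2 ^ p) *
      if truncLevel κ N n = 0 then 1 else truncLevel κ N n ^ (2 - p)) :
    ‖layerOp r n h‖ ≤ √(20 ^ (D + 1) * (1 + 2 ^ p)) * 2 ^ (-r * N) * decay (δ / 2) D N n := by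
  have h' : 0 ≤ (n : ℝ) - N := by simpa using hn.le
  have hp : (0 : ℝ) < 1 + 2 ^ p := by positivity
  have hb' := hb (layerBox (D + 1) n)
  unfold truncLevel at hb'
  rw [if_neg hn.not_ge, if_neg (rpow_pos_of_pos two_pos _).ne', ← rpow_mul zero_le_two] at hb'
  have hL : (0 : ℝ) ≤ (1 + 2 ^ p) * 2 ^ (κ * ((n : ℝ) - N) * (2 - p)) := by positivity
  rw [← Real.sq_sqrt hL] at hb'
  refine (norm_layerOp_le_of_sq hr hr1 (sqrt_nonneg _) hb').trans ?_
  rw [← sqrt_mul (by positivity)]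
  refine Real.sqrt_le_iff.2 ⟨by unfold decay; positivity, ?_⟩
  rw [mul_pow, mul_pow, Real.sq_sqrt (by positivity), decay, mul_pow, abs_of_nonneg h']
  have e1 : ((2 : ℝ) ^ (-r * N)) ^ 2 = 2 ^ (-2 * r * N) := by
    rw [← rpow_natCast, ← rpow_mul zero_le_two]; congr 1; push_cast; ring
  have e2 : ((2 : ℝ) ^ (-(δ / 2) * ((n : ℝ) - N))) ^ 2 = 2 ^ (-δ * ((n : ℝ) - N)) := by
    rw [← rpow_natCast, ← rpow_mul zero_le_two]; congr 1; push_cast; ring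
  rw [e1, e2]
  have e3 : ((n : ℝ) + 1) ^ D ≤ (((n : ℝ) + 1) ^ D) ^ 2 := by
    have : (1 : ℝ) ≤ ((n : ℝ) + 1) ^ D := one_le_pow₀ (by simp)
    nlinarith
  have e4 : (2 : ℝ) ^ ((1 - 2 * r) * (n : ℝ)) * 2 ^ (κ * ((n : ℝ) - N) * (2 - p)) ≤
      2 ^ (-2 * r * N) * 2 ^ (-δ * ((n : ℝ) - N)) := by
    rw [← rpow_add two_pos, ← rpow_add two_pos]
    refine rpow_le_rpow_of_exponent_le one_le_two ?_
    nlinarith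
  calc _ = 20 ^ (D + 1) * (1 + 2 ^ p) * (((n : ℝ) + 1) ^ D *
        ((2 : ℝ) ^ ((1 - 2 * r) * (n : ℝ)) * 2 ^ (κ * ((n : ℝ) - N) * (2 - p)))) := by ring
    _ ≤ 20 ^ (D + 1) * (1 + 2 ^ p) * ((((n : ℝ) + 1) ^ D) ^ 2 *
        (2 ^ (-2 * r * N) * 2 ^ (-δ * ((n : ℝ) - N)))) := by gcongr
    _ = _ := by ring

/-- Every function of the Sobolev ball is, up to a small uniform error, a weighted trigonometric
sum with square summable coefficients. -/
lemma exists_approximation {D : ℕ} {p r : ℝ} (hp : 2 < p) (hrp : 1 / p < r) (hr : r < 1 / 2) :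
    ∃ b δ C : ℝ, 0 < δ ∧ 0 < C ∧ ∀ N M : ℕ, (N : ℝ) + N / δ < M →
      ∑ n ∈ Finset.range M, ∑ k ∈ layerBox (D + 1) n,
        ((2 : ℝ) ^ (-(wExp b δ N n / 2)) * cLay r n k) ^ 2 ≤
          C * 2 ^ ((1 - 2 * r) * N) * ((N : ℝ) + 1) ^ D ∧
      ∀ (f : Lp ℂ ∞ (volume : Measure (Torus (D + 1))))
        (φ : Lp ℂ (ENNReal.ofReal p) (volume : Measure (Torus (D + 1)))), ‖φ‖ ≤ 2 →
        WRel (D + 1) r (ENNReal.ofReal p) f φ → ∃ (y : ℕ → (Fin (D + 1) → ℤ) → ℂ)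
          (ρ : C(Torus (D + 1), ℂ)),
          ∑ n ∈ Finset.range M, ∑ k ∈ layerBox (D + 1) n, ‖y n k‖ ^ 2 ≤ C ∧
          ‖ρ‖ ≤ C * 2 ^ (-r * N) * ((N : ℝ) + 1) ^ D ∧
          f = ContinuousMap.toLp ∞ volume ℂ (mainPart (D + 1) r b δ N M y + ρ) := by
  have hp0 : 0 < p := by linarith
  have hr0 : 0 < r := lt_trans (by positivity) hrp
  have hrp' : 1 < r * p := by rwa [div_lt_iff₀ hp0] at hrp
  obtain ⟨κ, hκ1, hκ2⟩ : ∃ κ, (1 - 2 * r) / (p - 2) < κ ∧ κ < r := by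
    refine exists_between ?_
    rw [div_lt_iff₀ (by linarith)]
    nlinarith
  rw [div_lt_iff₀ (by linarith)] at hκ1
  set b := κ * (p - 2) with hb
  set δ := min ((1 - 2 * r) / 2) ((b - (1 - 2 * r)) / 2) with hδ
  have hδ1 : 2 * δ ≤ 1 - 2 * r := by
    have := min_le_left ((1 - 2 * r) / 2) ((b - (1 - 2 * r)) / 2); linarith
  have hδ2 : 2 * δ ≤ b - (1 - 2 * r) := by
    have := min_le_right ((1 - 2 * r) / 2) ((b - (1 - 2 * r)) / 2); linarith
  have hδ0 : 0 < δ := lt_min (by linarith) (by linarith)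
  clear_value δ
  obtain ⟨C₁, hC₁, H₁⟩ := exists_decay_bound hδ0 D
  obtain ⟨C₂, hC₂, H₂⟩ := exists_decay_bound hδ0 0
  obtain ⟨C₃, hC₃, H₃⟩ := exists_decay_bound (half_pos hδ0) D
  obtain ⟨C₄, hC₄, H₄⟩ := exists_decay_bound (sub_pos.2 hκ2) D
  have h2p : (0 : ℝ) < 1 + 2 ^ p := by positivity
  set K := √(20 ^ (D + 1) * (1 + 2 ^ p)) with hK
  have hK0 : 0 ≤ K := sqrt_nonneg _
  set Cρ : ℝ := 5000 ^ (D + 1) * C₄ + K * C₃ with hCρ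
  have hCρ0 : 0 < Cρ := by positivity
  refine ⟨b, δ, 20 ^ (D + 1) * C₁ + (1 + 2 ^ p) * C₂ + Cρ, hδ0, by positivity, ?_⟩
  intro N M hM
  refine ⟨?_, ?_⟩
  · calc _ ≤ ∑ n ∈ Finset.range M, 20 ^ (D + 1) * 2 ^ ((1 - 2 * r) * N) * decay δ D N n :=
          Finset.sum_le_sum fun n _ =>
            sum_weighted_cLay_sq_le hr0.le (by linarith) hδ1 hδ2 N n
      _ ≤ 20 ^ (D + 1) * 2 ^ ((1 - 2 * r) * N) * ∑' n, decay δ D N n := by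
          rw [← Finset.mul_sum]
          gcongr
          exact (H₁ N).1.sum_le_tsum _ fun n _ => decay_nonneg _ _ _ _
      _ ≤ 20 ^ (D + 1) * 2 ^ ((1 - 2 * r) * N) * (C₁ * ((N : ℝ) + 1) ^ D) := by
          gcongr; exact (H₁ N).2
      _ = (20 ^ (D + 1) * C₁) * 2 ^ ((1 - 2 * r) * N) * ((N : ℝ) + 1) ^ D := by ring
      _ ≤ _ := by
          gcongr
          have : 0 ≤ (1 + 2 ^ p) * C₂ := by positivity
          linarith
  intro f φ hφ hrel
  choose g h hg hh hgh hgb hhb using fun n => exists_truncation hp hφ (truncLevel_nonneg κ N n)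
  set v : ℕ → ℝ := fun n => 2 ^ (wExp b δ N n / 2) with hv
  have hv2 : ∀ n, v n ^ 2 = 2 ^ wExp b δ N n := fun n => by
    rw [hv]; dsimp only
    rw [← rpow_natCast, ← rpow_mul zero_le_two]; congr 1; push_cast; ring
  have hadd : ∀ n, layerOp r n φ = layerOp r n (g n) + layerOp r n (h n) := fun n => by
    rw [← layerOp_add (hg n) (hh n)]
    congr 1
    exact funext (hgh n)
  set ρ : ℕ → C(Torus (D + 1), ℂ) := fun n =>
    if n < M then layerOp r n (g n) else layerOp r n φ with hρ
  have hρn : ∀ n, ‖ρ n‖ ≤ 5000 ^ (D + 1) * 2 ^ (-r * N) * decay (r - κ) D N n +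
      K * 2 ^ (-r * N) * decay (δ / 2) D N n := by
    intro n
    have hgn := norm_layerOp_bounded_le hr0.le (by linarith) (hg n) (hgb n)
    simp only [hρ]
    split_ifs with hn
    · refine hgn.trans (le_add_of_nonneg_right ?_)
      have := decay_nonneg (δ / 2) D N n
      positivity
    · rw [hadd]
      refine (norm_add_le _ _).trans (add_le_add hgn ?_)
      have hMn : (M : ℝ) ≤ n := by exact_mod_cast not_lt.1 hn
      have hN0 : (0 : ℝ) ≤ (N : ℝ) / δ := by positivity
      have hNn : (N : ℝ) / δ < n - N := by linarith
      rw [div_lt_iff₀ hδ0] at hNn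
      refine norm_layerOp_tail_le hr0.le (by linarith) hδ2 ?_ (by linarith) (hhb n)
      exact_mod_cast (by linarith : (N : ℝ) < n)
  have hρs : Summable fun n => 5000 ^ (D + 1) * 2 ^ (-r * N) * decay (r - κ) D N n +
      K * 2 ^ (-r * N) * decay (δ / 2) D N n :=
    ((H₄ N).1.mul_left _).add ((H₃ N).1.mul_left _)
  have hρsum : Summable ρ := Summable.of_norm_bounded hρs hρn
  refine ⟨fun n k => v n * fCoeff (h n) k, ∑' n, ρ n, ?_, ?_, ?_⟩
  · calc _ ≤ ∑ n ∈ Finset.range M, (1 + 2 ^ p) * decay δ 0 N n := by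
          refine Finset.sum_le_sum fun n _ => ?_
          have e : ∀ k, ‖(v n : ℂ) * fCoeff (h n) k‖ ^ 2 =
              2 ^ wExp b δ N n * ‖fCoeff (h n) k‖ ^ 2 := fun k => by
            rw [norm_mul, mul_pow, Complex.norm_real, norm_eq_abs, sq_abs, hv2]
          simp_rw [e, ← Finset.mul_sum]
          rw [← two_rpow_wExp_mul_le (p := p) (κ := κ), ← hb]
          refine (mul_le_mul_of_nonneg_left (hhb n _) (by positivity)).trans_eq (by ring)
      _ ≤ (1 + 2 ^ p) * (C₂ * ((N : ℝ) + 1) ^ 0) := by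
          rw [← Finset.mul_sum]
          gcongr
          exact ((H₂ N).1.sum_le_tsum _ fun n _ => decay_nonneg _ _ _ _).trans (H₂ N).2
      _ ≤ _ := by
          have : 0 ≤ 20 ^ (D + 1) * C₁ := by positivity
          rw [pow_zero, mul_one]
          linarith
  · calc _ ≤ ∑' n, (5000 ^ (D + 1) * 2 ^ (-r * N) * decay (r - κ) D N n +
          K * 2 ^ (-r * N) * decay (δ / 2) D N n) := tsum_of_norm_bounded hρs.hasSum hρn
      _ = 5000 ^ (D + 1) * 2 ^ (-r * N) * ∑' n, decay (r - κ) D N n +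
          K * 2 ^ (-r * N) * ∑' n, decay (δ / 2) D N n := by
          rw [((H₄ N).1.mul_left _).tsum_add ((H₃ N).1.mul_left _), tsum_mul_left, tsum_mul_left]
      _ ≤ 5000 ^ (D + 1) * 2 ^ (-r * N) * (C₄ * ((N : ℝ) + 1) ^ D) +
          K * 2 ^ (-r * N) * (C₃ * ((N : ℝ) + 1) ^ D) := by
          gcongr
          · exact (H₄ N).2
          · exact (H₃ N).2
      _ = Cρ * 2 ^ (-r * N) * ((N : ℝ) + 1) ^ D := by rw [hCρ]; ring
      _ ≤ _ := by
          gcongr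
          have : 0 ≤ 20 ^ (D + 1) * C₁ + (1 + 2 ^ p) * C₂ := by positivity
          linarith
  · have hmain : mainPart (D + 1) r b δ N M (fun n k => v n * fCoeff (h n) k) =
        ∑ n ∈ Finset.range M, layerOp r n (h n) := by
      unfold mainPart layerOp
      refine Finset.sum_congr rfl fun n _ => Finset.sum_congr rfl fun k _ => ?_
      have e : (2 : ℝ) ^ (-(wExp b δ N n / 2)) * v n = 1 := by
        rw [hv, ← rpow_add two_pos]; simp
      have e' : (((2 : ℝ) ^ (-(wExp b δ N n / 2)) : ℝ) : ℂ) * (v n : ℂ) = 1 := by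
        exact_mod_cast e
      congr 1
      rw [Complex.ofReal_mul]
      linear_combination (cLay r n k * fCoeff (h n) k) * e'
    have hs : HasSum (fun n => layerOp r n φ)
        (mainPart (D + 1) r b δ N M (fun n k => v n * fCoeff (h n) k) + ∑' n, ρ n) := by
      have h1 : HasSum (fun n => if n < M then layerOp r n (h n) else 0)
          (∑ n ∈ Finset.range M, layerOp r n (h n)) := by
        rw [Finset.sum_congr rfl fun n hn => (if_pos (Finset.mem_range.1 hn)).symm]
        exact hasSum_sum_of_ne_finset_zero fun n hn => if_neg (by simpa using hn)
      rw [hmain]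
      convert h1.add hρsum.hasSum using 1
      funext n
      simp only [hρ]
      split_ifs
      · exact (hadd n).trans (add_comm _ _)
      · rw [zero_add]
    refine eq_toLp_of_fCoeff_eq f _ fun k => ?_
    have h1 := (fCoeffCLM k).hasSum hs
    simp only [fCoeffCLM_apply, fCoeff_layerOp] at h1
    have h2 := ((Complex.hasSum_ofReal.2 (hasSum_cLay r k)).mul_right (fCoeff φ k))
    rw [hrel k]
    exact h2.unique h1

end Approximation

section LevelSelection

/-- Choosing the optimal level `N` for each `m`. -/
lemma exists_bound_of_levels {e : ℕ → ℝ} {D : ℕ} {r K : ℝ} (hr0 : 0 < r) (hr1 : r < 1)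
    (hK : 1 ≤ K)
    (h : ∀ N m : ℕ, K * 2 ^ N * ((N : ℝ) + 1) ≤ ((m : ℝ) - 2) * ((N : ℝ) + 1) ^ D →
      e m ≤ K * 2 ^ (-r * N) * ((N : ℝ) + 1) ^ D) :
    ∃ C : ℝ, 0 < C ∧ ∀ m : ℕ, 2 ≤ m →
      e m ≤ C * (m : ℝ) ^ (-r) * log m ^ ((D : ℝ) * (1 - r) + r) := by
  set s : ℝ := (D : ℝ) * (1 - r) + r with hs
  have hs0 : 0 < s := by
    have : 0 ≤ (D : ℝ) * (1 - r) := mul_nonneg (by positivity) (by linarith)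
    linarith
  have hlog : ∀ m : ℕ, 2 ≤ m → log 2 ≤ log m := fun m hm =>
    log_le_log two_pos (by exact_mod_cast hm)
  have hl2 : 0 < log 2 := log_pos one_lt_two
  obtain ⟨T, hT1, hT⟩ : ∃ T : ℝ, 1 ≤ T ∧ ∀ N : ℕ,
      ((N : ℝ) + 1) ^ D ≤ T * (2 : ℝ) ^ ((N : ℝ) / 2) := by
    have hsum := summable_pow_mul_two_rpow one_half_pos D
    refine ⟨1 + ∑' n : ℕ, ((n : ℝ) + 1) ^ D * (2 : ℝ) ^ (-(1 / 2) * (n : ℝ)), ?_, fun N => ?_⟩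
    · exact le_add_of_nonneg_right (tsum_nonneg fun n => by positivity)
    · have h1 := hsum.le_tsum N fun n _ => by positivity
      have h2 : ((N : ℝ) + 1) ^ D =
          ((N : ℝ) + 1) ^ D * (2 : ℝ) ^ (-(1 / 2) * (N : ℝ)) * 2 ^ ((N : ℝ) / 2) := by
        rw [mul_assoc, ← rpow_add two_pos, show -(1 / 2) * (N : ℝ) + N / 2 = 0 by ring, rpow_zero,
          mul_one]
      rw [h2]
      gcongr
      linarith
  have hlogT : 0 ≤ log T := log_nonneg hT1
  set c : ℝ := 2 * (log T / log 2 + 1) / log 2 + 2 / log 2 with hc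
  have hc0 : 0 < c := by positivity
  have hub : ∀ N m : ℕ, 2 ≤ m →
      K * 2 ^ N * ((N : ℝ) + 1) ≤ ((m : ℝ) - 2) * ((N : ℝ) + 1) ^ D →
      (N : ℝ) + 2 ≤ c * log m := by
    intro N m hm hN
    have hm' : (2 : ℝ) ≤ m := by exact_mod_cast hm
    have h2N : (2 : ℝ) ^ N = 2 ^ ((N : ℝ) / 2) * 2 ^ ((N : ℝ) / 2) := by
      rw [← rpow_add two_pos, add_halves, rpow_natCast]
    have hp : (0 : ℝ) < 2 ^ ((N : ℝ) / 2) := by positivity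
    have h1 : (2 : ℝ) ^ N ≤ K * 2 ^ N * ((N : ℝ) + 1) := by
      have : (1 : ℝ) ≤ (N : ℝ) + 1 := by simp
      have h3 : (0 : ℝ) < 2 ^ N := by positivity
      calc (2 : ℝ) ^ N = 1 * 2 ^ N * 1 := by ring
        _ ≤ _ := by gcongr
    have h3 : (2 : ℝ) ^ ((N : ℝ) / 2) * 2 ^ ((N : ℝ) / 2) ≤ m * T * 2 ^ ((N : ℝ) / 2) := by
      rw [← h2N]
      calc _ ≤ _ := h1.trans hN
        _ ≤ m * (T * (2 : ℝ) ^ ((N : ℝ) / 2)) := by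
            gcongr
            · linarith
            · exact hT N
        _ = _ := by ring
    have h4 := log_le_log hp (le_of_mul_le_mul_right h3 hp)
    rw [log_rpow two_pos, log_mul (by positivity) (by positivity)] at h4
    have h5 := hlog m hm
    have h6 : log T ≤ log T / log 2 * log m := by
      rw [div_mul_eq_mul_div, le_div_iff₀ hl2]
      gcongr
    have h7 : (N : ℝ) ≤ 2 * (log T / log 2 + 1) / log 2 * log m := by
      rw [div_mul_eq_mul_div, le_div_iff₀ hl2]
      linarith
    have h8 : 2 ≤ 2 / log 2 * log m := by
      rw [div_mul_eq_mul_div, le_div_iff₀ hl2]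
      linarith
    rw [hc, add_mul]
    linarith
  set C₁ : ℝ := K * (6 * K) ^ r * c ^ s with hC₁
  have hK0 : 0 < K := by linarith
  have hC₁0 : 0 < C₁ := by positivity
  have hlarge : ∀ m : ℕ, K + 2 ≤ m → e m ≤ C₁ * (m : ℝ) ^ (-r) * log m ^ s := by
    intro m hm
    have hm3 : (3 : ℝ) ≤ m := by linarith
    have hm2 : 2 ≤ m := by exact_mod_cast (by linarith : (2 : ℝ) ≤ m)
    have hlm : 0 < log m := hl2.trans_le (hlog m hm2)
    have hex : ∃ N : ℕ, ¬ K * 2 ^ N * ((N : ℝ) + 1) ≤ ((m : ℝ) - 2) * ((N : ℝ) + 1) ^ D := by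
      obtain ⟨N, hN⟩ := exists_nat_gt (c * log m)
      exact ⟨N, fun hh => by linarith [hub N m hm2 hh]⟩
    classical
    obtain ⟨N, hN⟩ : ∃ N, Nat.find hex = N + 1 := by
      refine Nat.exists_eq_succ_of_ne_zero fun h0 => ?_
      have := Nat.find_spec hex
      rw [h0] at this
      apply this
      simp
      linarith
    have hgood := not_not.1 (Nat.find_min hex (m := N) (by omega))
    have hbad := Nat.find_spec hex
    rw [hN, not_le] at hbad
    have hP := hub N m hm2 hgood
    set P : ℝ := (N : ℝ) + 2 with hPdef
    have hP0 : 0 < P := by positivity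
    push_cast at hbad
    rw [show (N : ℝ) + 1 + 1 = P by rw [hPdef]; ring, pow_succ] at hbad
    have hlow : (6 * K)⁻¹ * (m * P ^ ((D : ℝ) - 1)) ≤ (2 : ℝ) ^ (N : ℝ) := by
      rw [rpow_sub_one hP0.ne', rpow_natCast, rpow_natCast, inv_mul_le_iff₀ (by positivity),
        ← mul_div_assoc, div_le_iff₀ hP0]
      have : (m : ℝ) * P ^ D ≤ 3 * ((m - 2) * P ^ D) := by
        rw [← mul_assoc]
        gcongr
        linarith
      linarith
    have hpow : (2 : ℝ) ^ (-r * N) ≤ (6 * K) ^ r * (m : ℝ) ^ (-r) * P ^ (-r * ((D : ℝ) - 1)) := by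
      have h1 := rpow_le_rpow_of_nonpos (z := -r) (by positivity) hlow (by linarith)
      rw [← rpow_mul zero_le_two, mul_rpow (by positivity) (by positivity),
        mul_rpow (by positivity) (by positivity), inv_rpow (by positivity), rpow_neg (by positivity),
        inv_inv, ← rpow_mul hP0.le] at h1
      rw [mul_comm (-r) (N : ℝ), mul_comm (-r) ((D : ℝ) - 1)]
      rw [mul_assoc]
      exact h1
    calc e m ≤ K * 2 ^ (-r * N) * ((N : ℝ) + 1) ^ D := h N m hgood
      _ ≤ K * ((6 * K) ^ r * (m : ℝ) ^ (-r) * P ^ (-r * ((D : ℝ) - 1))) * P ^ D := by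
          gcongr
          rw [hPdef]; linarith
      _ = K * (6 * K) ^ r * (m : ℝ) ^ (-r) * (P ^ (-r * ((D : ℝ) - 1)) * P ^ (D : ℝ)) := by
          rw [rpow_natCast]; ring
      _ = K * (6 * K) ^ r * (m : ℝ) ^ (-r) * P ^ s := by
          rw [← rpow_add hP0, hs]
          congr 2; ring
      _ ≤ K * (6 * K) ^ r * (m : ℝ) ^ (-r) * (c * log m) ^ s := by gcongr
      _ = _ := by rw [mul_rpow hc0.le hlm.le, hC₁]; ring
  set rhs : ℕ → ℝ := fun m => (m : ℝ) ^ (-r) * log m ^ s with hrhs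
  have hrhs0 : ∀ m, 2 ≤ m → 0 < rhs m := fun m hm => by
    have : 0 < log m := hl2.trans_le (hlog m hm)
    have : (0 : ℝ) < m := by exact_mod_cast (by omega : 0 < m)
    simp only [hrhs]; positivity
  set C₂ : ℝ := ∑ m ∈ Finset.range ⌈K + 2⌉₊, |e m / rhs m| with hC₂
  have hC₂0 : 0 ≤ C₂ := Finset.sum_nonneg fun _ _ => abs_nonneg _
  refine ⟨C₁ + C₂, by positivity, fun m hm => ?_⟩
  rw [mul_assoc]
  change e m ≤ (C₁ + C₂) * rhs m
  have hpos := hrhs0 m hm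
  rcases le_or_gt (K + 2) m with hmK | hmK
  · have h1 := hlarge m hmK
    rw [mul_assoc] at h1
    change e m ≤ C₁ * rhs m at h1
    nlinarith
  · have h1 : |e m / rhs m| ≤ C₂ := Finset.single_le_sum (f := fun m => |e m / rhs m|)
      (fun _ _ => abs_nonneg _) (Finset.mem_range.2 (Nat.lt_ceil.2 hmK))
    have h2 := (le_abs_self _).trans h1
    rw [div_le_iff₀ hpos] at h2
    nlinarith

end LevelSelection

section Entropy

lemma norm_toLp_top_le {d : ℕ} (G : C(Torus d, ℂ)) :
    ‖ContinuousMap.toLp ∞ (volume : Measure (Torus d)) ℂ G‖ ≤ ‖G‖ := by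
  have h := ContinuousMap.toLp_norm_le (p := ∞) (𝕜 := ℂ) (E := ℂ) (volume : Measure (Torus d))
  simp only [ENNReal.toReal_top, inv_zero, rpow_zero] at h
  refine (ContinuousLinearMap.le_of_opNorm_le _ h G).trans_eq (one_mul _)

lemma exists_lift_norm_le {d : ℕ} {r : ℝ} {q : ℝ≥0∞} (f : WSpace d r q) (hf : ‖f‖ ≤ 1) :
    ∃ φ : Lp ℂ q (volume : Measure (Torus d)), WRel d r q f.1 φ ∧ ‖φ‖ ≤ 2 := by
  obtain ⟨φ₀, hφ₀⟩ := f.2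
  have hne : {c : ℝ | ∃ φ : Lp ℂ q (volume : Measure (Torus d)),
      WRel d r q f.1 φ ∧ ‖φ‖ = c}.Nonempty := ⟨_, φ₀, hφ₀, rfl⟩
  obtain ⟨c, ⟨φ, hφ, rfl⟩, hc⟩ := exists_lt_of_csInf_lt hne (lt_of_le_of_lt hf one_lt_two)
  exact ⟨φ, hφ, hc.le⟩

lemma eN_le_of_finset {A B : Type*} [Norm A] [NormedAddCommGroup B] {T : A → B} {m : ℕ} {ε : ℝ}
    (hε : 0 < ε) {S : Finset B} (hS : S.card ≤ 2 ^ (m - 1))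
    (h : ∀ a : A, ‖a‖ ≤ 1 → ∃ b ∈ S, ‖T a - b‖ ≤ ε) : eN T m ≤ ε :=
  csInf_le ⟨0, fun _ hx => hx.1.le⟩ ⟨hε, S, hS, h⟩

lemma exists_net_mainPart {d : ℕ} {r b δ A R ε : ℝ} {N M Q : ℕ} (hA : 0 < A) (hR : 0 ≤ R)
    (hε : 0 < ε) (hQ : 0 < Q)
    (hw : ∑ n ∈ Finset.range M, ∑ k ∈ layerBox d n,
      ((2 : ℝ) ^ (-(wExp b δ N n / 2)) * cLay r n k) ^ 2 ≤ A ^ 2) :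
    ∃ Z : Finset C(Torus d, ℂ),
      (Z.card : ℝ) ≤ 2 * exp (4 * (A * R / ε) ^ 2 * log (4 * (Q ^ d * 2))) ∧
      ∀ y : ℕ → (Fin d → ℤ) → ℂ,
        ∑ n ∈ Finset.range M, ∑ k ∈ layerBox d n, ‖y n k‖ ^ 2 ≤ R ^ 2 → ∃ z ∈ Z,
        ‖mainPart d r b δ N M y - z‖ ≤
          2 * ε + 2 * (A * R * (d * 2 ^ M * (2 * π / Q))) := by
  set I : Finset (Σ _ : ℕ, Fin d → ℤ) := (Finset.range M).sigma fun n => layerBox d n with hI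
  have hsum : ∀ {E : Type} [AddCommMonoid E] (F : ℕ → (Fin d → ℤ) → E),
      ∑ i : I, F i.1.1 i.1.2 = ∑ n ∈ Finset.range M, ∑ k ∈ layerBox d n, F n k := by
    intro E _ F
    rw [Finset.sum_coe_sort I (fun i => F i.1 i.2), hI, Finset.sum_sigma]
  obtain ⟨Z, hZ, hnet⟩ := exists_net_trigSum (d := d) (ι := I)
    (w := fun i => (2 : ℝ) ^ (-(wExp b δ N i.1.1 / 2)) * cLay r i.1.1 i.1.2)
    (κ := fun i => i.1.2) (A := A) (R := R) (M := 2 ^ M) (ε := ε) (Q := Q) hA hR (by positivity)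
    hε hQ (by
      rw [hsum fun n k => ((2 : ℝ) ^ (-(wExp b δ N n / 2)) * cLay r n k) ^ 2]
      exact hw)
    (by
      rintro ⟨⟨n, k⟩, hi⟩ j
      rw [hI, Finset.mem_sigma, Fintype.mem_piFinset] at hi
      have h1 := Finset.mem_Icc.1 (hi.2 j)
      have h2 : |k j| ≤ (2 ^ (n + 1) : ℕ) := abs_le.2 h1
      have h3 : (2 : ℤ) ^ (n + 1) ≤ 2 ^ M :=
        pow_le_pow_right₀ one_le_two (Finset.mem_range.1 hi.1)
      push_cast at h2
      exact_mod_cast h2.trans h3)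
  refine ⟨Z, hZ, fun y hy => ?_⟩
  obtain ⟨z, hz, hzy⟩ := hnet (fun i => y i.1.1 i.1.2) (by
    rw [hsum fun n k => ‖y n k‖ ^ 2]
    exact hy)
  refine ⟨z, hz, ?_⟩
  have : mainPart d r b δ N M y = trigSum
      (fun i : I => (2 : ℝ) ^ (-(wExp b δ N i.1.1 / 2)) * cLay r i.1.1 i.1.2)
      (fun i => i.1.2) (fun i => y i.1.1 i.1.2) := by
    unfold mainPart trigSum
    rw [hsum fun n k => (((2 : ℝ) ^ (-(wExp b δ N n / 2)) * cLay r n k : ℝ) * y n k) •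
      (trigChar k : C(Torus d, ℂ))]
  rw [this]
  exact hzy

/-- The entropy bound at level `N`. -/
lemma exists_eN_le {D : ℕ} {p r : ℝ} (hp : 2 < p) (hrp : 1 / p < r) (hr : r < 1 / 2) :
    ∃ K : ℝ, 1 ≤ K ∧ ∀ N m : ℕ,
      K * 2 ^ N * ((N : ℝ) + 1) ≤ ((m : ℝ) - 2) * ((N : ℝ) + 1) ^ D →
      eN (fun f : WSpace (D + 1) r (ENNReal.ofReal p) =>
          (f.1 : Lp ℂ ∞ (volume : Measure (Torus (D + 1))))) m ≤
        K * 2 ^ (-r * N) * ((N : ℝ) + 1) ^ D := by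
  obtain ⟨b, δ, C, hδ, hC, H⟩ := exists_approximation (D := D) hp hrp hr
  set c : ℝ := log 8 + ((D : ℝ) + 1) * (3 + 1 / δ) with hc
  have hc0 : 0 < c := by
    have : 0 < log 8 := log_pos (by norm_num)
    positivity
  set K₁ : ℝ := 4 * C ^ 2 * c / log 2 with hK₁
  have hl2 : 0 < log 2 := log_pos one_lt_two
  have hK₁0 : 0 < K₁ := by positivity
  set K₂ : ℝ := 2 + 2 * C * ((D : ℝ) + 1) * (2 * π) + C with hK₂
  have hK₂0 : 0 < K₂ := by positivity
  refine ⟨1 + K₁ + K₂, by linarith, fun N m hNm => ?_⟩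
  set X : ℝ := (N : ℝ) + 1 with hX
  have hX1 : 1 ≤ X := by simp [hX]
  have hX0 : 0 < X := by positivity
  set M : ℕ := N + ⌊(N : ℝ) / δ⌋₊ + 1 with hM
  have hMlt : (N : ℝ) + N / δ < M := by
    have := Nat.lt_floor_add_one ((N : ℝ) / δ)
    rw [hM]; push_cast; linarith
  have hMle : (M : ℝ) + N ≤ (3 + 1 / δ) * X := by
    have := Nat.floor_le (a := (N : ℝ) / δ) (by positivity)
    have h1 : (0 : ℝ) ≤ 1 / δ := by positivity
    have h2 : (0 : ℝ) ≤ N := by positivity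
    have h3 : (N : ℝ) / δ = 1 / δ * N := by ring
    rw [hM, hX]; push_cast; nlinarith
  clear_value M
  obtain ⟨hw, Happ⟩ := H N M hMlt
  set ε : ℝ := 2 ^ (-r * N) * X ^ D with hε
  have hε0 : 0 < ε := by positivity
  set A : ℝ := √(C * 2 ^ ((1 - 2 * r) * N) * X ^ D) with hA
  have hA0 : 0 < A := sqrt_pos.2 (by positivity)
  have hA2 : A ^ 2 = C * 2 ^ ((1 - 2 * r) * N) * X ^ D := Real.sq_sqrt (by positivity)
  have hR2 : √C ^ 2 = C := Real.sq_sqrt hC.le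
  have hAR : (A * √C / ε) ^ 2 * X ^ D = C ^ 2 * 2 ^ N := by
    rw [div_pow, mul_pow, hA2, hR2, hε, mul_pow]
    have e1 : (2 : ℝ) ^ ((1 - 2 * r) * N) = (2 ^ (-r * N)) ^ 2 * 2 ^ N := by
      rw [← rpow_natCast, ← rpow_mul zero_le_two, ← rpow_natCast, ← rpow_add two_pos]
      congr 1; push_cast; ring
    have e2 : (2 : ℝ) ^ (-r * N) ≠ 0 := (rpow_pos_of_pos two_pos _).ne'
    rw [e1]
    field_simp
  have hXD : (1 : ℝ) ≤ X ^ D := one_le_pow₀ hX1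
  have hARle : A * √C ≤ C * 2 ^ N * ε := by
    have h1 : (A * √C / ε) ^ 2 ≤ (C * 2 ^ N) ^ 2 := by
      have h2 : (1 : ℝ) ≤ 2 ^ N := one_le_pow₀ one_le_two
      have h3 := sq_nonneg (A * √C / ε)
      calc _ ≤ (A * √C / ε) ^ 2 * X ^ D := le_mul_of_one_le_right h3 hXD
        _ = C ^ 2 * (2 ^ N * 1) := by rw [hAR, mul_one]
        _ ≤ C ^ 2 * (2 ^ N * 2 ^ N) := by gcongr
        _ = _ := by ring
    have h2 := le_of_sq_le_sq h1 (by positivity)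
    rwa [div_le_iff₀ hε0] at h2
  obtain ⟨Z, hZ, hnet⟩ := exists_net_mainPart (Q := 2 ^ (M + N)) hA0 (sqrt_nonneg C) hε0
    (by positivity) (hw.trans_eq hA2.symm)
  have hlogQ : log (4 * (((2 ^ (M + N) : ℕ) : ℝ) ^ (D + 1) * 2)) ≤ c * X := by
    have e : 4 * (((2 ^ (M + N) : ℕ) : ℝ) ^ (D + 1) * 2) = 8 * 2 ^ ((M + N) * (D + 1)) := by
      push_cast; rw [← pow_mul]; ring
    rw [e, log_mul (by norm_num) (by positivity), log_pow]
    have h8 : 0 ≤ log 8 := log_nonneg (by norm_num)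
    have hl1 : log 2 ≤ 1 := by linarith [log_two_lt_d9]
    have h1 : log 8 ≤ log 8 * X := le_mul_of_one_le_right h8 hX1
    push_cast
    calc _ ≤ log 8 * X + ((3 + 1 / δ) * X * ((D : ℝ) + 1)) * 1 := by gcongr
      _ = _ := by rw [hc]; ring
  have hcard : Z.card ≤ 2 ^ (m - 1) := by
    have hm2 : (2 : ℝ) ≤ m := by
      by_contra! hlt
      have h1 : ((m : ℝ) - 2) * X ^ D < 0 := mul_neg_of_neg_of_pos (by linarith) (by positivity)
      have h2 : 0 ≤ (1 + K₁ + K₂) * 2 ^ N * X := by positivity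
      linarith
    have hm2' : 2 ≤ m := by exact_mod_cast hm2
    have hexp : 4 * (A * √C / ε) ^ 2 * log (4 * (((2 ^ (M + N) : ℕ) : ℝ) ^ (D + 1) * 2)) ≤
        ((m : ℝ) - 2) * log 2 := by
      refine le_of_mul_le_mul_right ?_ (by positivity : 0 < X ^ D)
      calc _ ≤ 4 * (A * √C / ε) ^ 2 * (c * X) * X ^ D := by gcongr
        _ = 4 * ((A * √C / ε) ^ 2 * X ^ D) * (c * X) := by ring
        _ = log 2 * (K₁ * 2 ^ N * X) := by rw [hAR, hK₁]; field_simp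
        _ ≤ log 2 * ((1 + K₁ + K₂) * 2 ^ N * X) := by gcongr; linarith
        _ ≤ log 2 * (((m : ℝ) - 2) * X ^ D) := by gcongr
        _ = _ := by ring
    have hreal : (Z.card : ℝ) ≤ 2 ^ (m - 1) := by
      refine hZ.trans ?_
      have e : (2 : ℝ) ^ (m - 1) = 2 * exp (((m : ℝ) - 2) * log 2) := by
        obtain ⟨j, rfl⟩ := Nat.exists_eq_add_of_le hm2'
        have : 2 + j - 1 = j + 1 := by omega
        rw [this, pow_succ']
        push_cast
        rw [add_sub_cancel_left, mul_comm (j : ℝ), exp_mul, exp_log two_pos, rpow_natCast]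
      rw [e]
      gcongr
    exact_mod_cast hreal
  have hfin : ∀ f : WSpace (D + 1) r (ENNReal.ofReal p), ‖f‖ ≤ 1 →
      ∃ z ∈ Z.image (ContinuousMap.toLp ∞ (volume : Measure (Torus (D + 1))) ℂ),
        ‖f.1 - z‖ ≤ K₂ * ε := by
    intro f hf
    obtain ⟨φ, hφ, hφ2⟩ := exists_lift_norm_le f hf
    obtain ⟨y, ρ, hy, hρ, hfy⟩ := Happ f.1 φ hφ2 hφ
    obtain ⟨z, hz, hzy⟩ := hnet y (hy.trans_eq hR2.symm)
    refine ⟨_, Finset.mem_image_of_mem _ hz, ?_⟩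
    rw [hfy, ← map_sub]
    refine (norm_toLp_top_le _).trans ?_
    rw [add_sub_right_comm]
    refine (norm_add_le _ _).trans ((add_le_add hzy hρ).trans ?_)
    have e : (2 : ℝ) ^ N * (2 ^ M * (2 * π / ((2 ^ (M + N) : ℕ) : ℝ))) = 2 * π := by
      push_cast; rw [pow_add]; field_simp
    calc _ ≤ 2 * ε + 2 * (C * 2 ^ N * ε * (((D + 1 : ℕ) : ℝ) * 2 ^ M *
          (2 * π / ((2 ^ (M + N) : ℕ) : ℝ)))) + C * 2 ^ (-r * N) * X ^ D := by gcongr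
      _ = 2 * ε + 2 * C * ε * ((D : ℝ) + 1) *
          (2 ^ N * (2 ^ M * (2 * π / ((2 ^ (M + N) : ℕ) : ℝ)))) + C * ε := by
          rw [hε]; push_cast; ring
      _ = K₂ * ε := by rw [e, hK₂]; ring
  refine (eN_le_of_finset (by positivity) (Finset.card_image_le.trans hcard) hfin).trans ?_
  rw [hε, mul_assoc]
  gcongr
  linarith

end Entropy

theorem stmt18 (d : ℕ) (hd : 1 ≤ d) (p r : ℝ) (hp : 2 < p)
    (hrp : 1 / p < r) (hr : r < 1 / 2) :
    ∃ C : ℝ, 0 < C ∧ ∀ m : ℕ, 2 ≤ m →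
      eN (fun f : WSpace d r (ENNReal.ofReal p) =>
          (f.1 : Lp ℂ ∞ (volume : Measure (Torus d)))) m ≤
        C * (m : ℝ) ^ (-r) * Real.log m ^ ((d - 1 : ℝ) * (1 - r) + r) := by
  obtain ⟨D, rfl⟩ := Nat.exists_eq_succ_of_ne_zero (Nat.one_le_iff_ne_zero.1 hd)
  obtain ⟨K, hK, h⟩ := exists_eN_le (D := D) hp hrp hr
  have hr0 : 0 < r := lt_trans (by positivity) hrp
  obtain ⟨C, hC, hb⟩ := exists_bound_of_levels hr0 (by linarith) hK h
  refine ⟨C, hC, fun m hm => ?_⟩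
  rw [Nat.cast_succ, add_sub_cancel_right]
  exact hb m hm

end
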